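/- arXiv:2103.08965 — 3 statements merged into one kernel-verified Lean document; each statement's English description precedes it below -/
import Mathlib

section
/- For v ∈ W^{1,∞}(0,T) with v(0) = 0 and (∂_t^α v)² ∈ W^{1,1}(0,T), and α ∈ (0,1), one has ∫₀ᵗ (∂_t^α v)(s) v_t(s) ds ≥ (1/(2Γ(α) t^{1-α})) ‖∂_t^α v‖²_{L²(0,t)} for all t ∈ (0,T). -/
open MeasureTheory intervalIntegral Set

/-- Abel (Riemann–Liouville) integral operator of order `γ ∈ (0,1]`. -/
noncomputable def abel (γ : ℝ) (v : ℝ → ℝ) (t : ℝ) : ℝ :=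
  (1 / Real.Gamma γ) * ∫ s in (0:ℝ)..t, v s / (t - s) ^ (1 - γ)

/-- Caputo fractional derivative of order `α ∈ (0,1)`: `∂_t^α v = I_t^{1-α}[v']`. -/
noncomputable def caputo (α : ℝ) (v : ℝ → ℝ) (t : ℝ) : ℝ :=
  abel (1 - α) (deriv v) t

open Filter Topology

noncomputable def cv (k g : ℝ → ℝ) (s : ℝ) : ℝ := ∫ r, k r * g (s - r)

structure Ker (k : ℝ → ℝ) : Prop where
  meas : Measurable k
  nonneg : ∀ x, 0 ≤ k x
  int : Integrable k
  zero : ∀ x ≤ 0, k x = 0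
  anti : ∀ x y, 0 < x → x ≤ y → k y ≤ k x

lemma cv_meas {k g : ℝ → ℝ} (hk : Measurable k) (hg : Measurable g) : Measurable (cv k g) := by
  have : Measurable (fun p : ℝ × ℝ => k p.2 * g (p.1 - p.2)) := by fun_prop
  exact (this.stronglyMeasurable.integral_prod_right).measurable

lemma cv_int {k g : ℝ → ℝ} {C : ℝ} (hk : Integrable k) (hg : Measurable g)
    (hC : ∀ x, |g x| ≤ C) (s : ℝ) : Integrable (fun r => k r * g (s - r)) := by
  refine hk.mul_bdd (c := C) ?_ ?_
  · exact (by fun_prop : Measurable fun r => g (s - r)).aestronglyMeasurable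
  · exact ae_of_all _ fun r => hC _

lemma cv_bound {k g : ℝ → ℝ} {C : ℝ} (hk : Integrable k) 
    (hC : ∀ x, |g x| ≤ C) (s : ℝ) : |cv k g s| ≤ C * ∫ r, |k r| := by
  rw [← MeasureTheory.integral_const_mul]
  unfold cv
  rw [← Real.norm_eq_abs]
  refine MeasureTheory.norm_integral_le_of_norm_le (hk.abs.const_mul C) (ae_of_all _ fun r => ?_)
  rw [norm_mul, mul_comm]
  exact mul_le_mul_of_nonneg_right (hC _) (abs_nonneg _)

lemma cv_shift (k g : ℝ → ℝ) (s h : ℝ) : cv k g (s - h) = ∫ r, k (r - h) * g (s - r) := by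
  unfold cv
  rw [← integral_sub_right_eq_self (fun r => k r * g (s - h - r)) h]
  congr 1; ext r; congr 2; ring

lemma cv_swap (k g : ℝ → ℝ) (s : ℝ) : cv k g s = ∫ x, k (s - x) * g x := by
  unfold cv
  rw [← integral_sub_left_eq_self (fun r => k r * g (s - r)) volume s]
  congr 1; ext r; congr 2; ring

lemma cv_sub {k g : ℝ → ℝ} {C : ℝ} (hk : Integrable k) (hg : Measurable g)
    (hC : ∀ x, |g x| ≤ C) (s h : ℝ) :
    cv k g s - cv k g (s - h) = ∫ r, (k r - k (r - h)) * g (s - r) := by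
  rw [cv_shift]
  unfold cv
  rw [← integral_sub (cv_int hk hg hC s) (cv_int (hk.comp_sub_right h) hg hC s)]
  congr 1; ext r; ring

lemma ker_diff {k : ℝ → ℝ} (hk : Ker k) {h : ℝ} (hh : 0 < h) (r : ℝ) :
    k r - k (r - h) ≤ (Iic h).indicator k r ∧
      |k r - k (r - h)| = 2 * (Iic h).indicator k r - (k r - k (r - h)) := by
  by_cases hr : r ≤ h
  · have h1 : k (r - h) = 0 := hk.zero _ (by linarith)
    rw [indicator_of_mem (by exact hr), h1, sub_zero, abs_of_nonneg (hk.nonneg r)]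
    exact ⟨le_rfl, by ring⟩
  · have h1 := hk.anti (r - h) r (by push Not at hr; linarith) (by linarith)
    rw [indicator_of_notMem (by exact hr), abs_of_nonpos (by linarith)]
    exact ⟨by linarith, by ring⟩

lemma ker_diff_zero {k : ℝ → ℝ} (hk : Ker k) (h : ℝ) : ∫ r, (k r - k (r - h)) = 0 := by
  rw [integral_sub hk.int (hk.int.comp_sub_right h), integral_sub_right_eq_self, sub_self]

lemma cv_holder {k g : ℝ → ℝ} {C : ℝ} (hk : Ker k) (hg : Measurable g)
    (hC : ∀ x, |g x| ≤ C) (s : ℝ) {h : ℝ} (hh : 0 < h) :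
    |cv k g s - cv k g (s - h)| ≤ C * (2 * ∫ r in Iic h, k r) := by
  have hi : Integrable fun r => k r - k (r - h) := hk.int.sub (hk.int.comp_sub_right h)
  have hii : Integrable ((Iic h).indicator k) := hk.int.indicator measurableSet_Iic
  have := cv_bound hi hC s
  rw [cv_sub hk.int hg hC]
  refine this.trans (le_of_eq ?_)
  congr 1
  simp_rw [fun r => (ker_diff hk hh r).2]
  rw [integral_sub (hii.const_mul 2) hi, ker_diff_zero hk, MeasureTheory.integral_const_mul,
    MeasureTheory.integral_indicator measurableSet_Iic, sub_zero]

lemma cv_key {k w : ℝ → ℝ} {C D : ℝ} (hk : Ker k) (hw : Measurable w)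
    (hC : ∀ x, |w x| ≤ C) (s : ℝ) {h : ℝ} (hh : 0 < h)
    (hD : ∀ r, 0 < r → r ≤ h → |w s - w (s - r)| ≤ D) :
    (cv k (fun x => w x ^ 2) s - cv k (fun x => w x ^ 2) (s - h)) / 2
      - D ^ 2 / 2 * ∫ r in Iic h, k r ≤ w s * (cv k w s - cv k w (s - h)) := by
  have hi : Integrable fun r => k r - k (r - h) := hk.int.sub (hk.int.comp_sub_right h)
  have hii : Integrable ((Iic h).indicator k) := hk.int.indicator measurableSet_Iic
  have hC2 : ∀ x, |w x ^ 2| ≤ C ^ 2 := fun x => by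
    rw [abs_pow]; exact pow_le_pow_left₀ (abs_nonneg _) (hC x) 2
  rw [cv_sub hk.int hw hC, cv_sub hk.int (hw.pow_const 2) hC2]
  have e1 := cv_int hi hw hC s
  have e2 := cv_int hi (hw.pow_const 2) hC2 s
  have : (∫ r, ((1/2) * (w s ^ 2 * (k r - k (r - h))) + (1/2) * ((k r - k (r - h)) * w (s - r) ^ 2)
      - D ^ 2 / 2 * (Iic h).indicator k r)) ≤ ∫ r, w s * ((k r - k (r - h)) * w (s - r)) := by
    refine integral_mono ((((hi.const_mul _).const_mul _).add (e2.const_mul _)).sub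
      (hii.const_mul _)) (e1.const_mul _) fun r => ?_
    have hd := (ker_diff hk hh r).1
    dsimp only
    by_cases hr : r ≤ h
    · rw [indicator_of_mem (by exact hr)] at hd ⊢
      have h1 : k (r - h) = 0 := hk.zero _ (by linarith)
      rw [h1, sub_zero]
      rcases le_or_gt r 0 with h0 | h0
      · rw [hk.zero r h0]; simp
      · have := hD r h0 hr
        have h2 : (w s - w (s - r)) ^ 2 ≤ D ^ 2 := by
          rw [← sq_abs]; exact pow_le_pow_left₀ (abs_nonneg _) this 2
        nlinarith [mul_le_mul_of_nonneg_left h2 (hk.nonneg r)]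
    · rw [indicator_of_notMem (by exact hr)] at hd ⊢
      nlinarith [mul_nonneg (neg_nonneg.2 hd) (sq_nonneg (w s - w (s - r)))]
  have f1 : Integrable fun r => (1/2) * (w s ^ 2 * (k r - k (r - h))) :=
    (hi.const_mul _).const_mul _
  have f2 : Integrable fun r => (1/2) * ((k r - k (r - h)) * w (s - r) ^ 2) := e2.const_mul _
  have f3 : Integrable fun r => D ^ 2 / 2 * (Iic h).indicator k r := hii.const_mul _
  have f12 : Integrable fun r => (1/2) * (w s ^ 2 * (k r - k (r - h)))
      + (1/2) * ((k r - k (r - h)) * w (s - r) ^ 2) := f1.add f2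
  rw [integral_sub f12 f3, integral_add f1 f2] at this
  simp only [MeasureTheory.integral_const_mul] at this
  rw [ker_diff_zero hk, MeasureTheory.integral_indicator measurableSet_Iic] at this
  linarith

lemma bdd_ii {g : ℝ → ℝ} {C : ℝ} (hg : Measurable g) (hC : ∀ x, |g x| ≤ C) (a b : ℝ) :
    IntervalIntegrable g volume a b := by
  refine (intervalIntegrable_const (c := C)).mono_fun hg.aestronglyMeasurable
    (ae_of_all _ fun x => ?_)
  exact (hC x).trans (le_abs_self C)

lemma cv_lower {k w : ℝ → ℝ} {C : ℝ} (hk : Ker k) (hw : Measurable w)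
    (hC : ∀ x, |w x| ≤ C) {s t h : ℝ} (h1 : t - h ≤ s) (h2 : s ≤ t) (hht : 0 ≤ t - h) :
    k t * ∫ x in (0:ℝ)..(t - h), w x ^ 2 ≤ cv k (fun x => w x ^ 2) s := by
  have hC2 : ∀ x, |w x ^ 2| ≤ C ^ 2 := fun x => by
    rw [abs_pow]; exact pow_le_pow_left₀ (abs_nonneg _) (hC x) 2
  have hI : Integrable fun x => k (s - x) * w x ^ 2 := by
    have := (cv_int hk.int (hw.pow_const 2) hC2 s).comp_sub_left s
    simpa using this
  rw [cv_swap, intervalIntegral.integral_of_le hht, ← MeasureTheory.integral_const_mul,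
    integral_Ioc_eq_integral_Ioo]
  refine le_trans ?_ (setIntegral_le_integral hI (s := Ioo 0 (t - h))
    (ae_of_all _ fun x => mul_nonneg (hk.nonneg _) (sq_nonneg _)))
  refine setIntegral_mono_on ?_ hI.integrableOn measurableSet_Ioo fun x hx => ?_
  · have := (bdd_ii (hw.pow_const 2) hC2 0 (t - h))
    rw [intervalIntegrable_iff_integrableOn_Ioo_of_le hht] at this
    exact this.const_mul _
  · exact mul_le_mul_of_nonneg_right (hk.anti _ _ (by linarith [hx.2]) (by linarith [hx.1]))
      (sq_nonneg _)

lemma cv_main {k w : ℝ → ℝ} {C D : ℝ} (hk : Ker k) (hw : Measurable w)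
    (hC : ∀ x, |w x| ≤ C) (hw0 : ∀ x ≤ 0, w x = 0) {h t : ℝ} (hh : 0 < h) (hht : h < t)
    (hD : ∀ s r, 0 < r → r ≤ h → |w s - w (s - r)| ≤ D) :
    h * (k t / 2 * ∫ x in (0:ℝ)..(t - h), w x ^ 2) - t * (D ^ 2 / 2 * ∫ r in Iic h, k r)
      ≤ ∫ s in (0:ℝ)..t, w s * (cv k w s - cv k w (s - h)) := by
  have hC2 : ∀ x, |w x ^ 2| ≤ C ^ 2 := fun x => by
    rw [abs_pow]; exact pow_le_pow_left₀ (abs_nonneg _) (hC x) 2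
  set V := cv k (fun x => w x ^ 2) with hV
  have hVm : Measurable V := cv_meas hk.meas (hw.pow_const 2)
  have hVb := cv_bound hk.int hC2
  have hVi := bdd_ii hVm hVb
  have hVs : IntervalIntegrable (fun s => V (s - h)) volume 0 t :=
    bdd_ii (hVm.comp (measurable_id.sub_const h)) (fun x => hVb (x - h)) 0 t
  have hvm : Measurable (cv k w) := cv_meas hk.meas hw
  have hvb := cv_bound hk.int hC
  have hR : IntervalIntegrable (fun s => w s * (cv k w s - cv k w (s - h))) volume 0 t := by
    refine bdd_ii (C := C * (C * (2 * ∫ r in Iic h, k r)))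
      (hw.mul (hvm.sub (hvm.comp (measurable_id.sub_const h)))) (fun x => ?_) 0 t
    simp only [Pi.mul_apply, abs_mul]
    exact mul_le_mul (hC x) (cv_holder hk hw hC x hh) (abs_nonneg _)
      ((abs_nonneg _).trans (hC x))
  have h0 : ∫ s in (0:ℝ)..t, ((V s - V (s - h)) / 2 - D ^ 2 / 2 * ∫ r in Iic h, k r)
      ≤ ∫ s in (0:ℝ)..t, w s * (cv k w s - cv k w (s - h)) := by
    refine intervalIntegral.integral_mono_on (by linarith)
      ((((hVi 0 t).sub hVs).div_const 2).sub intervalIntegrable_const) hR fun s _ => ?_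
    exact cv_key hk hw hC s hh (hD s)
  rw [intervalIntegral.integral_sub (((hVi 0 t).sub hVs).div_const 2) intervalIntegrable_const,
    intervalIntegral.integral_div, intervalIntegral.integral_sub (hVi 0 t) hVs,
    intervalIntegral.integral_const, intervalIntegral.integral_comp_sub_right (fun s => V s) h]
    at h0
  have hz : ∫ s in (0 - h)..0, V s = 0 := by
    rw [intervalIntegral.integral_congr (g := fun _ => (0:ℝ))]
    · simp
    · intro s hs
      rw [uIcc_of_le (by linarith)] at hs
      simp only [hV, cv]
      rw [← integral_zero ℝ ℝ]
      congr 1; ext r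
      rcases le_or_gt r 0 with h0 | h0
      · rw [hk.zero r h0]; simp
      · rw [hw0 (s - r) (by linarith [hs.2])]; simp
  have hsplit1 := intervalIntegral.integral_add_adjacent_intervals (hVi (0 - h) 0) (hVi 0 (t - h))
  have hsplit2 := intervalIntegral.integral_add_adjacent_intervals (hVi 0 (t - h)) (hVi (t - h) t)
  have hlow : ∫ s in (t - h)..t, (k t * ∫ x in (0:ℝ)..(t - h), w x ^ 2)
      ≤ ∫ s in (t - h)..t, V s :=
    intervalIntegral.integral_mono_on (by linarith) intervalIntegrable_const (hVi _ _)
      fun s hs => cv_lower hk hw hC hs.1 hs.2 (by linarith)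
  rw [intervalIntegral.integral_const] at hlow
  simp only [smul_eq_mul] at hlow h0
  rw [sub_zero] at h0
  have e : t - (t - h) = h := by ring
  rw [e] at hlow
  linarith

lemma cv_assoc {k₁ k₂ g : ℝ → ℝ} {C : ℝ} (h1 : Ker k₁) (h2 : Ker k₂) (hg : Measurable g)
    (hC : ∀ x, |g x| ≤ C) (s : ℝ) : cv (cv k₁ k₂) g s = cv k₁ (cv k₂ g) s := by
  refine convolution_assoc (ContinuousLinearMap.mul ℝ ℝ) (ContinuousLinearMap.mul ℝ ℝ)
    (ContinuousLinearMap.mul ℝ ℝ) (ContinuousLinearMap.mul ℝ ℝ) (μ := volume) (ν := volume)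
    (f := k₁) (g := k₂) (k := g) (x₀ := s) ?_ h1.meas.aestronglyMeasurable
    h2.meas.aestronglyMeasurable hg.aestronglyMeasurable ?_ ?_ ?_
  · intro x y z; simp [mul_assoc]
  · exact Integrable.ae_convolution_exists _ h1.int h2.int
  · refine ae_of_all _ fun x => ?_
    exact cv_int h2.int.norm hg.norm (C := C) (by simpa using hC) x
  · have hb : ∀ x, |cv (fun x => ‖k₂ x‖) (fun x => ‖g x‖) x| ≤ _ :=
      cv_bound h2.int.norm (C := C) (by simpa using hC)
    exact cv_int h1.int.norm (cv_meas h2.meas.norm hg.norm) hb s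

noncomputable def kk (γ T : ℝ) : ℝ → ℝ :=
  (Ioo 0 T).indicator (fun x => x ^ (γ - 1) / Real.Gamma γ)

lemma kk_ker {γ T : ℝ} (h0 : 0 < γ) (h1 : γ < 1) (hT : 0 < T) : Ker (kk γ T) := by
  have hG := Real.Gamma_pos_of_pos h0
  have hn : ∀ x, 0 ≤ kk γ T x := fun x => indicator_nonneg
    (fun x hx => div_nonneg (Real.rpow_nonneg hx.1.le _) hG.le) x
  refine ⟨?_, hn, ?_, ?_, ?_⟩
  · exact Measurable.indicator (by fun_prop) measurableSet_Ioo
  · refine IntegrableOn.integrable_indicator ?_ measurableSet_Ioo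
    rw [← intervalIntegrable_iff_integrableOn_Ioo_of_le hT.le]
    exact (intervalIntegral.intervalIntegrable_rpow' (by linarith)).div_const _
  · intro x hx
    exact indicator_of_notMem (fun h => absurd h.1 (by linarith)) _
  · intro x y hx hxy
    by_cases hy : y < T
    · unfold kk
      rw [indicator_of_mem (by exact ⟨by linarith, hy⟩),
        indicator_of_mem (by exact ⟨hx, by linarith⟩)]
      exact div_le_div_of_nonneg_right
        (Real.rpow_le_rpow_of_nonpos hx hxy (by linarith)) hG.le
    · rw [show kk γ T y = 0 from indicator_of_notMem (fun h => hy h.2) _]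
      exact hn x

lemma kk_int {γ T h : ℝ} (h0 : 0 < γ) (h1 : γ < 1) (hT : 0 < T) (hh : 0 < h) (hhT : h < T) :
    ∫ r in Iic h, kk γ T r = h ^ γ / (γ * Real.Gamma γ) := by
  have : ∫ r in Iic h, kk γ T r = ∫ r in Ioc 0 h, r ^ (γ - 1) / Real.Gamma γ := by
    rw [← MeasureTheory.integral_indicator measurableSet_Iic, ← MeasureTheory.integral_indicator measurableSet_Ioc]
    congr 1; ext r
    unfold kk
    by_cases hr : r ≤ h <;> by_cases hr0 : 0 < r
    · rw [indicator_of_mem (by exact hr), indicator_of_mem (by exact ⟨hr0, by linarith⟩),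
        indicator_of_mem (by exact ⟨hr0, hr⟩)]
    · rw [indicator_of_mem (by exact hr), indicator_of_notMem (fun h => hr0 h.1),
        indicator_of_notMem (fun h => hr0 h.1)]
    · rw [indicator_of_notMem (by exact hr), indicator_of_notMem (fun h => hr h.2)]
    · rw [indicator_of_notMem (by exact hr), indicator_of_notMem (fun h => hr h.2)]
  rw [this, ← intervalIntegral.integral_of_le hh.le, intervalIntegral.integral_div,
    integral_rpow (Or.inl (by linarith)), sub_add_cancel, Real.zero_rpow h0.ne', sub_zero, div_div]
lemma kk_beta {α T u : ℝ} (h0 : 0 < α) (h1 : α < 1) (hu : 0 < u) (huT : u < T) :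
    cv (kk α T) (kk (1 - α) T) u = 1 := by
  have hG := Real.Gamma_pos_of_pos h0
  have hG' := Real.Gamma_pos_of_pos (sub_pos.2 h1)
  have e : cv (kk α T) (kk (1 - α) T) u = ∫ x in Ioc 0 u,
      (x ^ (α - 1) * (u - x) ^ (1 - α - 1)) / (Real.Gamma α * Real.Gamma (1 - α)) := by
    rw [integral_Ioc_eq_integral_Ioo, ← MeasureTheory.integral_indicator measurableSet_Ioo]
    unfold cv
    congr 1; ext r
    unfold kk
    by_cases hr : r ∈ Ioo 0 u
    · rw [indicator_of_mem hr, indicator_of_mem (by exact ⟨hr.1, by linarith [hr.2]⟩),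
        indicator_of_mem (by exact ⟨by linarith [hr.2], by linarith [hr.1]⟩), div_mul_div_comm]
    · rw [indicator_of_notMem hr]
      by_cases hr0 : 0 < r
      · rw [indicator_of_notMem (a := u - r), mul_zero]
        exact fun h => hr ⟨hr0, by linarith [h.1]⟩
      · rw [indicator_of_notMem (a := r), zero_mul]
        exact fun h => hr0 h.1
  rw [e, ← intervalIntegral.integral_of_le hu.le, intervalIntegral.integral_div,
    div_eq_one_iff_eq (by positivity)]
  have hb := Complex.betaIntegral_scaled (α : ℂ) ((1 - α : ℝ) : ℂ) hu
  have hg := Complex.Gamma_mul_Gamma_eq_betaIntegral (s := (α : ℂ)) (t := ((1 - α : ℝ) : ℂ))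
    (by simpa using h0) (by simpa using h1)
  rw [show (α : ℂ) + ((1 - α : ℝ) : ℂ) = 1 by push_cast; ring] at hb hg
  rw [sub_self, Complex.cpow_zero, one_mul] at hb
  rw [Complex.Gamma_one, one_mul, ← hb, Complex.Gamma_ofReal, Complex.Gamma_ofReal] at hg
  apply Complex.ofReal_injective
  rw [Complex.ofReal_mul, hg, ← intervalIntegral.integral_ofReal]
  refine intervalIntegral.integral_congr fun x hx => ?_
  rw [uIcc_of_le hu.le] at hx
  rw [Complex.ofReal_mul, Complex.ofReal_cpow hx.1, Complex.ofReal_cpow (by linarith [hx.2])]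
  push_cast
  rfl

lemma cv_beta {α T K s : ℝ} (h0 : 0 < α) (h1 : α < 1) (hT : 0 < T) {F : ℝ → ℝ}
    (hF : Measurable F) (hK : ∀ x, |F x| ≤ K) (hF0 : ∀ x, x ∉ Ioo 0 T → F x = 0) (hs : s ≤ T) :
    cv (kk α T) (cv (kk (1 - α) T) F) s = ∫ x in Iic s, F x := by
  rw [integral_Iic_eq_integral_Iio]
  rw [← cv_assoc (kk_ker h0 h1 hT) (kk_ker (sub_pos.2 h1) (by linarith) hT) hF hK, cv_swap,
    ← MeasureTheory.integral_indicator measurableSet_Iio]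
  congr 1; ext x
  by_cases hx : x ∈ Ioo 0 T
  · by_cases hxs : x < s
    · rw [kk_beta h0 h1 (by linarith) (by linarith [hx.1]), indicator_of_mem (by exact hxs),
        one_mul]
    · rw [indicator_of_notMem (by exact hxs)]
      have : cv (kk α T) (kk (1 - α) T) (s - x) = 0 := by
        unfold cv
        rw [← integral_zero ℝ ℝ]
        congr 1; ext r
        rcases le_or_gt r 0 with hr | hr
        · rw [(kk_ker h0 h1 hT).zero r hr]; simp
        · rw [(kk_ker (sub_pos.2 h1) (by linarith) hT).zero (s - x - r) (by linarith)]; simp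
      rw [this, zero_mul]
  · rw [hF0 x hx, mul_zero, eq_comm]
    exact indicator_apply_eq_zero.2 fun _ => hF0 x hx
/-- **Lemma 2.1 (coercivity)**: for `v ∈ W^{1,∞}(0,T)` with `v(0)=0` and
`(∂_t^α v)² ∈ W^{1,1}(0,T)`, and `α ∈ (0,1)`,
`∫₀ᵗ (∂_t^α v)(s) v'(s) ds ≥ (1/(2Γ(α) t^{1-α})) ‖∂_t^α v‖²_{L²(0,t)}`. -/
theorem alikhanov_coercivity (α T : ℝ) (hα : α ∈ Set.Ioo (0:ℝ) 1) (hT : 0 < T)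
    (v : ℝ → ℝ) (K : NNReal) (hv : LipschitzOnWith K v (Set.Icc 0 T))
    (hv0 : v 0 = 0)
    (hac : ∀ t ∈ Set.Icc (0:ℝ) T,
      (caputo α v t) ^ 2 = (caputo α v 0) ^ 2
        + ∫ s in (0:ℝ)..t, deriv (fun r => (caputo α v r) ^ 2) s)
    (hint : IntervalIntegrable (deriv (fun r => (caputo α v r) ^ 2)) volume 0 T) :
    ∀ t ∈ Set.Ioo (0:ℝ) T,
      (∫ s in (0:ℝ)..t, caputo α v s * deriv v s)
        ≥ (1 / (2 * Real.Gamma α * t ^ (1 - α)))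
            * ∫ s in (0:ℝ)..t, (caputo α v s) ^ 2 := by
  obtain ⟨h0, h1⟩ := hα
  have hb0 : 0 < 1 - α := sub_pos.2 h1
  have hb1 : 1 - α < 1 := by linarith
  have hG := Real.Gamma_pos_of_pos h0
  have hG' := Real.Gamma_pos_of_pos hb0
  have kA := kk_ker h0 h1 hT
  have kB := kk_ker hb0 hb1 hT
  set F : ℝ → ℝ := (Ioo 0 T).indicator (deriv v) with hF
  have hFm : Measurable F := (measurable_deriv v).indicator measurableSet_Ioo
  have hF0 : ∀ x, x ∉ Ioo 0 T → F x = 0 := fun x hx => indicator_of_notMem hx _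
  have hF1 : ∀ x, x ∈ Ioo 0 T → F x = deriv v x := fun x hx => indicator_of_mem hx _
  have hFK : ∀ x, |F x| ≤ (K : ℝ) := by
    intro x
    by_cases hx : x ∈ Ioo 0 T
    · rw [hF1 x hx]
      exact norm_deriv_le_of_lipschitzOn (Icc_mem_nhds hx.1 hx.2) hv
    · rw [hF0 x hx, abs_zero]; exact K.2
  set W := cv (kk (1 - α) T) F with hW
  have hWm : Measurable W := cv_meas kB.meas hFm
  obtain ⟨C, hWC⟩ : ∃ C, ∀ x, |W x| ≤ C := ⟨_, cv_bound kB.int hFK⟩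
  have hW0 : ∀ x ≤ 0, W x = 0 := by
    intro x hx
    simp only [hW, cv]
    rw [← integral_zero ℝ ℝ]
    congr 1; ext r
    rcases le_or_gt r 0 with hr | hr
    · rw [kB.zero r hr]; simp
    · rw [hF0 (x - r) (fun h => absurd h.1 (by linarith))]; simp
  have hcap : ∀ s ∈ Icc 0 T, caputo α v s = W s := by
    intro s hs
    simp only [caputo, abel, hW]
    rw [cv_swap, intervalIntegral.integral_of_le hs.1, ← MeasureTheory.integral_const_mul,
      integral_Ioc_eq_integral_Ioo, ← MeasureTheory.integral_indicator measurableSet_Ioo]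
    congr 1; ext x
    by_cases hx : x ∈ Ioo 0 s
    · rw [indicator_of_mem hx, hF1 x ⟨hx.1, by linarith [hx.2, hs.2]⟩]
      unfold kk
      rw [indicator_of_mem (by exact ⟨by linarith [hx.2], by linarith [hx.1, hs.2]⟩),
        show 1 - α - 1 = -(1 - (1 - α)) by ring, Real.rpow_neg (by linarith [hx.2])]
      ring
    · rw [indicator_of_notMem hx]
      by_cases hx0 : 0 < x
      · rw [kB.zero (s - x) (by by_contra h; exact hx ⟨hx0, by linarith⟩), zero_mul]
      · rw [hF0 x fun h => hx0 h.1, mul_zero]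
  have hFi : ∀ a b, IntervalIntegrable F volume a b := bdd_ii hFm hFK
  have hFI : Integrable F := by
    have := hFi 0 T
    rw [intervalIntegrable_iff_integrableOn_Ioo_of_le hT.le] at this
    have h2 := this.integrable_indicator measurableSet_Ioo
    rwa [hF, indicator_indicator, inter_self] at h2
  set u := cv (kk α T) W with hu
  have hum : Measurable u := cv_meas kA.meas hWm
  have hu1 : ∀ s ≤ T, u s = ∫ x in Iic s, F x := fun s hs => cv_beta h0 h1 hT hFm hFK hF0 hs
  have hu2 : ∀ s ≤ T, ∀ s' ≤ T, u s - u s' = ∫ x in s'..s, F x := by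
    intro s hs s' hs'
    rw [hu1 s hs, hu1 s' hs', intervalIntegral.integral_Iic_sub_Iic hFI.integrableOn
      hFI.integrableOn]
  have hulip : ∀ s ≤ T, ∀ h, 0 < h → |u s - u (s - h)| ≤ K * h := by
    intro s hs h hh
    rw [hu2 s hs (s - h) (by linarith)]
    have := intervalIntegral.norm_integral_le_of_norm_le_const (a := s - h) (b := s) (f := F)
      (C := K) (fun x _ => hFK x)
    rwa [sub_sub_cancel, abs_of_pos hh] at this
  have hu00 : u 0 = 0 := by
    rw [hu1 0 hT.le]
    rw [setIntegral_eq_zero_of_forall_eq_zero]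
    intro x hx
    exact hF0 x fun h => absurd h.1 (not_lt.2 hx)
  have huv : ∀ s ∈ Icc 0 T, u s = v s := by
    intro s hs
    have e1 := hu2 s hs.2 0 hT.le
    have hac' : AbsolutelyContinuousOnInterval v 0 s := by
      refine LipschitzOnWith.absolutelyContinuousOnInterval (K := K) (hv.mono ?_)
      rw [uIcc_of_le hs.1]
      exact Icc_subset_Icc_right hs.2
    have e2 := hac'.integral_deriv_eq_sub
    rw [hu00, sub_zero] at e1
    rw [hv0, sub_zero] at e2
    rw [e1, ← e2, intervalIntegral.integral_of_le hs.1, intervalIntegral.integral_of_le hs.1,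
      integral_Ioc_eq_integral_Ioo, integral_Ioc_eq_integral_Ioo]
    exact setIntegral_congr_fun measurableSet_Ioo
      fun x hx => hF1 x ⟨hx.1, lt_of_lt_of_le hx.2 hs.2⟩
  intro t ht
  have htI : ∀ x ∈ uIcc 0 t, x ∈ Icc 0 T := by
    intro x hx
    rw [uIcc_of_le ht.1.le] at hx
    exact ⟨hx.1, hx.2.trans ht.2.le⟩
  rw [ge_iff_le, intervalIntegral.integral_congr (f := fun s => caputo α v s ^ 2)
      (g := fun s => W s ^ 2)
      (fun s hs => by simp only [hcap s (htI s hs)]),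
    intervalIntegral.integral_congr (f := fun s => caputo α v s * deriv v s)
      (g := fun s => W s * deriv v s)
      (fun s hs => by simp only [hcap s (htI s hs)])]
  set A := 2 * K / ((1 - α) * Real.Gamma (1 - α)) with hA
  have hA0 : 0 ≤ A := by positivity
  set E := A ^ 2 / 2 / (α * Real.Gamma α) with hE
  have hC2 : ∀ x, |W x ^ 2| ≤ C ^ 2 := fun x => by
    rw [abs_pow]; exact pow_le_pow_left₀ (abs_nonneg _) (hWC x) 2
  have hW2i : ∀ a b, IntervalIntegrable (fun s => W s ^ 2) volume a b :=
    bdd_ii (hWm.pow_const 2) hC2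
  have hlim1 : Tendsto (fun h => kk α T t / 2 * (∫ x in (0:ℝ)..(t - h), W x ^ 2)
      - t * (E * h ^ (1 - α))) (𝓝[>] 0) (𝓝 (kk α T t / 2 * ∫ x in (0:ℝ)..t, W x ^ 2)) := by
    refine Tendsto.mono_left ?_ nhdsWithin_le_nhds
    have c1 : Continuous fun h : ℝ => ∫ x in (0:ℝ)..(t - h), W x ^ 2 :=
      (intervalIntegral.continuous_primitive hW2i 0).comp (continuous_const.sub continuous_id)
    have c2 : Continuous fun h : ℝ => h ^ (1 - α) := Real.continuous_rpow_const hb0.le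
    have c3 : Continuous fun h : ℝ => kk α T t / 2 * (∫ x in (0:ℝ)..(t - h), W x ^ 2)
      - t * (E * h ^ (1 - α)) := by fun_prop
    have := c3.tendsto 0
    simpa [Real.zero_rpow hb0.ne'] using this
  have hlim2 : Tendsto (fun h => ∫ s in (0:ℝ)..t, W s * ((u s - u (s - h)) / h)) (𝓝[>] 0)
      (𝓝 (∫ s in (0:ℝ)..t, W s * deriv v s)) := by
    refine intervalIntegral.tendsto_integral_filter_of_dominated_convergence (fun _ => C * K)
      ?_ ?_ intervalIntegrable_const ?_
    · refine Eventually.of_forall fun h => Measurable.aestronglyMeasurable ?_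
      fun_prop
    · filter_upwards [self_mem_nhdsWithin] with h hh
      refine ae_of_all _ fun s hs => ?_
      rw [uIoc_of_le ht.1.le] at hs
      rw [norm_mul, norm_div, Real.norm_of_nonneg (le_of_lt (show 0 < h from hh))]
      refine mul_le_mul (hWC s) ?_ (div_nonneg (norm_nonneg _) (le_of_lt hh))
        ((abs_nonneg _).trans (hWC s))
      rw [div_le_iff₀ hh]
      exact hulip s (hs.2.trans ht.2.le) h hh
    · filter_upwards [hv.ae_differentiableWithinAt_of_mem_real] with s hsd hs
      rw [uIoc_of_le ht.1.le] at hs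
      have hsT : s < T := lt_of_le_of_lt hs.2 ht.2
      have hd : HasDerivAt v (deriv v s) s :=
        ((hsd ⟨hs.1.le, hsT.le⟩).differentiableAt (Icc_mem_nhds hs.1 hsT)).hasDerivAt
      refine Tendsto.const_mul _ ?_
      have h3 := hd.tendsto_slope_zero
      have h4 : Tendsto (fun h : ℝ => -h) (𝓝[>] 0) (𝓝[≠] 0) := by
        refine tendsto_nhdsWithin_iff.2 ⟨?_, ?_⟩
        · exact Tendsto.mono_left (by simpa using (continuous_neg (G := ℝ)).tendsto 0)
            nhdsWithin_le_nhds
        · filter_upwards [self_mem_nhdsWithin] with h hh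
          exact neg_ne_zero.2 (ne_of_gt hh)
      refine (h3.comp h4).congr' ?_
      filter_upwards [Ioo_mem_nhdsGT hs.1] with h hh
      rw [huv s ⟨hs.1.le, hsT.le⟩, huv (s - h) ⟨by linarith [hh.2], by linarith [hh.1]⟩]
      simp only [Function.comp, smul_eq_mul, ← sub_eq_add_neg]
      have := hh.1.ne'
      field_simp
      ring
  have hle : kk α T t / 2 * (∫ x in (0:ℝ)..t, W x ^ 2) ≤ ∫ s in (0:ℝ)..t, W s * deriv v s := by
    refine le_of_tendsto_of_tendsto hlim1 hlim2 ?_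
    filter_upwards [Ioo_mem_nhdsGT ht.1] with h hh
    have hhT : h < T := hh.2.trans ht.2
    have hm := cv_main kA hWm hWC hW0 hh.1 hh.2 (D := A * h ^ (1 - α)) ?_
    · rw [kk_int h0 h1 hT hh.1 hhT] at hm
      have e1 : (∫ s in (0:ℝ)..t, W s * ((u s - u (s - h)) / h))
          = (∫ s in (0:ℝ)..t, W s * (u s - u (s - h))) / h := by
        rw [← intervalIntegral.integral_div]
        congr 1; ext s; ring
      rw [e1, le_div_iff₀ hh.1]
      refine le_trans (le_of_eq ?_) hm
      have e2 : h ^ (1 - α) * h ^ α = h := by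
        rw [← Real.rpow_add hh.1]; simp
      rw [hE]
      have e3 : (A * h ^ (1 - α)) ^ 2 / 2 * (h ^ α / (α * Real.Gamma α))
         = A ^ 2 / 2 / (α * Real.Gamma α) * h ^ (1 - α) * (h ^ (1 - α) * h ^ α) := by ring
      rw [e3, e2]
      ring
    · intro s r hr hrh
      refine (cv_holder kB hFm hFK s hr).trans ?_
      rw [kk_int hb0 hb1 hT hr (by linarith)]
      have : r ^ (1 - α) ≤ h ^ (1 - α) := Real.rpow_le_rpow hr.le hrh hb0.le
      refine le_trans (le_of_eq ?_) (mul_le_mul_of_nonneg_left this hA0)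
      rw [hA]; ring
  refine le_trans (le_of_eq ?_) hle
  congr 1
  unfold kk
  rw [indicator_of_mem (by exact ht), show α - 1 = -(1 - α) by ring, Real.rpow_neg ht.1.le]
  field_simp
end

section
/- Let α ∈ (0,1) and b₂ > 0. If ũ := b₂ ∂_t^α u + u belongs to W^{1,∞}(0,T) and u(0) = 0, then u is determined uniquely from ũ by the fractional relaxation ODE b₂ ∂_t^α u + u = ũ, and u ∈ W^{1,∞}(0,T); in particular the solution map ũ ↦ u is linear and bounded on L^∞(0,T): ‖u‖_{L^∞(0,t)} ≤ ‖ũ‖_{L^∞(0,t)} for all t. -/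
open MeasureTheory intervalIntegral Set

lemma beta_int {α a : ℝ} (h0 : 0 < α) (h1 : α < 1) (ha : 0 < a) :
    ∫ x in (0:ℝ)..a, (a - x) ^ (α - 1) * x ^ (-α) = Real.Gamma α * Real.Gamma (1 - α) := by
  have h := Complex.betaIntegral_scaled ((1 - α : ℝ) : ℂ) (α : ℂ) ha
  have h2 := Complex.Gamma_mul_Gamma_eq_betaIntegral (s := ((1 - α : ℝ) : ℂ)) (t := (α : ℂ))
    (by simpa using h1) (by simpa using h0)
  have e : ((1 - α : ℝ) : ℂ) + (α : ℂ) = 1 := by push_cast; ring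
  rw [e, Complex.Gamma_one, one_mul] at h2
  rw [e, sub_self, Complex.cpow_zero, one_mul, ← h2] at h
  have h3 : ∫ x in (0:ℝ)..a, (x : ℂ) ^ (((1 - α : ℝ) : ℂ) - 1) * ((a : ℂ) - x) ^ ((α : ℂ) - 1)
      = ∫ x in (0:ℝ)..a, (((a - x) ^ (α - 1) * x ^ (-α) : ℝ) : ℂ) := by
    apply intervalIntegral.integral_congr
    intro x hx
    rw [uIcc_of_le ha.le] at hx
    simp only
    rw [Complex.ofReal_mul, Complex.ofReal_cpow (by linarith [hx.2]), Complex.ofReal_cpow hx.1]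
    push_cast
    rw [mul_comm]
    congr 2
    ring
  rw [h3, intervalIntegral.integral_ofReal, Complex.Gamma_ofReal, Complex.Gamma_ofReal] at h
  have h4 : (∫ x in (0:ℝ)..a, (a - x) ^ (α - 1) * x ^ (-α)) =
    Real.Gamma (1 - α) * Real.Gamma α := by exact_mod_cast h
  rw [h4, mul_comm]

lemma beta_int' {α r t : ℝ} (h0 : 0 < α) (h1 : α < 1) (ha : r < t) :
    ∫ s in r..t, (t - s) ^ (α - 1) * (s - r) ^ (-α) = Real.Gamma α * Real.Gamma (1 - α) := by
  have h := beta_int h0 h1 (sub_pos.2 ha)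
  have := intervalIntegral.integral_comp_sub_right (a := r) (b := t)
    (fun x => (t - r - x) ^ (α - 1) * x ^ (-α)) r
  rw [sub_self, h] at this
  rw [← this]
  congr 1
  ext s
  congr 2
  ring

lemma fubini_abel {α t : ℝ} (h0 : 0 < α) (h1 : α < 1) (ht : 0 < t) {g : ℝ → ℝ}
    (hg : IntervalIntegrable g volume 0 t) :
    ∫ s in (0:ℝ)..t, (t - s) ^ (α - 1) * abel (1 - α) g s
      = Real.Gamma α * ∫ s in (0:ℝ)..t, g s := by
  set B := Real.Gamma α * Real.Gamma (1 - α) with hB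
  have hG1 : 0 < Real.Gamma (1 - α) := Real.Gamma_pos_of_pos (by linarith)
  have hG0 : 0 < Real.Gamma α := Real.Gamma_pos_of_pos h0
  have hBpos : 0 < B := mul_pos hG0 hG1
  set μ := (volume : Measure ℝ).restrict (Ioc 0 t) with hμ
  let k : ℝ → ℝ → ℝ := fun s r => (Ioi r).indicator (fun s => (t - s) ^ (α - 1) * (s - r) ^ (-α)) s
  let F : ℝ → ℝ → ℝ := fun s r => k s r * g r
  have hgi : Integrable g μ := by
    rwa [intervalIntegrable_iff_integrableOn_Ioc_of_le ht.le] at hg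
  have hkmeas : Measurable (Function.uncurry k) := by
    have : Function.uncurry k = {p : ℝ × ℝ | p.2 < p.1}.indicator
        (fun p => (t - p.1) ^ (α - 1) * (p.1 - p.2) ^ (-α)) := by
      ext ⟨s, r⟩
      simp [k, Set.indicator, Function.uncurry]
    rw [this]
    refine Measurable.indicator ?_ (measurableSet_lt measurable_snd measurable_fst)
    fun_prop
  have hk1 : ∀ r, 0 < r → r < t → ∫ s, k s r ∂μ = B := by
    intro r hr hrt
    simp only [k, hμ]
    rw [setIntegral_indicator measurableSet_Ioi]
    have : Ioc 0 t ∩ Ioi r = Ioc r t := by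
      ext x; simp only [mem_inter_iff, mem_Ioc, mem_Ioi]; constructor
      · rintro ⟨⟨_, h⟩, h'⟩; exact ⟨h', h⟩
      · rintro ⟨h, h'⟩; exact ⟨⟨by linarith, h'⟩, h⟩
    rw [this, ← intervalIntegral.integral_of_le hrt.le, beta_int' h0 h1 hrt]
  have hk2 : ∀ r, 0 < r → r < t → Integrable (fun s => k s r) μ := by
    intro r hr hrt
    by_contra hn
    have := hk1 r hr hrt
    rw [integral_undef hn] at this
    linarith
  have hk0 : ∀ r, ∀ᵐ s ∂μ, 0 ≤ k s r := by
    intro r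
    refine (ae_restrict_iff' measurableSet_Ioc).2 (Filter.Eventually.of_forall fun s hs => ?_)
    refine Set.indicator_apply_nonneg fun h => ?_
    exact mul_nonneg (Real.rpow_nonneg (by linarith [hs.2]) _)
      (Real.rpow_nonneg (by linarith [mem_Ioi.1 h]) _)
  have hrange : ∀ᵐ r ∂μ, 0 < r ∧ r < t := by
    rw [hμ, Measure.restrict_congr_set (Ioo_ae_eq_Ioc (a := (0:ℝ)) (b := t)).symm]
    exact (ae_restrict_iff' measurableSet_Ioo).2 (Filter.Eventually.of_forall fun s hs => hs)
  have hFint : Integrable (Function.uncurry F) (μ.prod μ) := by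
    have hm : AEStronglyMeasurable (Function.uncurry F) (μ.prod μ) := by
      have : Function.uncurry F = fun p => Function.uncurry k p * g p.2 := by
        ext ⟨s, r⟩; rfl
      rw [this]
      exact hkmeas.aestronglyMeasurable.mul hgi.aestronglyMeasurable.comp_snd
    rw [integrable_prod_iff' hm]
    constructor
    · filter_upwards [hrange] with r hr
      exact (hk2 r hr.1 hr.2).mul_const (g r)
    · refine (hgi.norm.const_mul B).congr ?_
      filter_upwards [hrange] with r hr
      rw [← hk1 r hr.1 hr.2, ← MeasureTheory.integral_mul_const]
      refine integral_congr_ae ?_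
      filter_upwards [hk0 r] with s hs
      simp only [F, Function.uncurry, norm_mul, Real.norm_eq_abs, abs_of_nonneg hs]
  have hswap := integral_integral_swap hFint
  have hR : ∫ r, ∫ s, F s r ∂μ ∂μ = B * ∫ s in (0:ℝ)..t, g s := by
    rw [intervalIntegral.integral_of_le ht.le, ← MeasureTheory.integral_const_mul]
    refine integral_congr_ae ?_
    filter_upwards [hrange] with r hr
    simp only [F]
    rw [MeasureTheory.integral_mul_const, hk1 r hr.1 hr.2]
  have hL : ∫ s, ∫ r, F s r ∂μ ∂μ = Real.Gamma (1 - α) *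
      ∫ s in (0:ℝ)..t, (t - s) ^ (α - 1) * abel (1 - α) g s := by
    rw [intervalIntegral.integral_of_le ht.le, ← MeasureTheory.integral_const_mul]
    refine setIntegral_congr_fun measurableSet_Ioc fun s hs => ?_
    have e1 : ∀ r, F s r = (Iio s).indicator
        (fun r => (t - s) ^ (α - 1) * ((s - r) ^ (-α) * g r)) r := by
      intro r
      by_cases h : r < s
      · simp [F, k, h, mul_assoc]
      · simp [F, k, h]
    simp only [e1]
    rw [hμ, setIntegral_indicator measurableSet_Iio]
    have : Ioc 0 t ∩ Iio s = Ioo 0 s := by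
      ext x; simp only [mem_inter_iff, mem_Ioc, mem_Iio, mem_Ioo]; constructor
      · rintro ⟨⟨h, _⟩, h'⟩; exact ⟨h, h'⟩
      · rintro ⟨h, h'⟩; exact ⟨⟨h, by linarith [hs.2]⟩, h'⟩
    rw [this, MeasureTheory.integral_const_mul, abel, intervalIntegral.integral_of_le hs.1.le,
      integral_Ioc_eq_integral_Ioo]
    have : ∫ r in Ioo 0 s, (s - r) ^ (-α) * g r = ∫ r in Ioo 0 s, g r / (s - r) ^ (1 - (1 - α)) := by
      refine setIntegral_congr_fun measurableSet_Ioo fun r hr => ?_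
      rw [Real.rpow_neg (by linarith [hr.2]), sub_sub_cancel]
      ring
    rw [this]
    field_simp
  rw [hL, hR, hB] at hswap
  apply mul_left_cancel₀ hG1.ne'
  rw [hswap]; ring

lemma kern_int {α T : ℝ} (h0 : 0 < α) {f : ℝ → ℝ} (hf : Continuous f) :
    IntervalIntegrable (fun x => x ^ (α - 1) * f x) volume 0 T :=
  (intervalIntegral.intervalIntegrable_rpow' (by linarith)).mul_continuousOn hf.continuousOn

lemma conv_eq {α t T : ℝ} (h0 : 0 < α) (ht0 : 0 ≤ t) (htT : t ≤ T) {Z : ℝ → ℝ}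
    (hZ : Continuous Z) (hZ0 : ∀ x ≤ 0, Z x = 0) :
    ∫ x in (0:ℝ)..T, x ^ (α - 1) * Z (t - x) = ∫ s in (0:ℝ)..t, (t - s) ^ (α - 1) * Z s := by
  have hi : ∀ S, IntervalIntegrable (fun x => x ^ (α - 1) * Z (t - x)) volume 0 S :=
    fun S => kern_int h0 (by fun_prop)
  rw [← intervalIntegral.integral_add_adjacent_intervals (hi t) ((hi t).symm.trans (hi T))]
  have : ∫ x in t..T, x ^ (α - 1) * Z (t - x) = 0 := by
    rw [intervalIntegral.integral_congr (g := fun _ => 0)]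
    · simp
    · intro x hx
      rw [uIcc_of_le htT] at hx
      simp only
      rw [hZ0 _ (by linarith [hx.1]), mul_zero]
  rw [this, add_zero]
  have := intervalIntegral.integral_comp_sub_left (a := 0) (b := t)
    (fun x => x ^ (α - 1) * Z (t - x)) t
  rw [sub_self, sub_zero] at this
  rw [← this]
  congr 1
  ext s
  rw [sub_sub_cancel]

lemma volterra {α b T : ℝ} (h0 : 0 < α) (h1 : α < 1) {g U V : ℝ → ℝ}
    (hg : IntervalIntegrable g volume 0 T) (hU : Continuous U) (hV : Continuous V)
    (hU0 : ∀ x ≤ 0, U x = 0) (hV0 : ∀ x ≤ 0, V x = 0)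
    (hUg : ∀ t ∈ Icc 0 T, U t = ∫ s in (0:ℝ)..t, g s)
    (heq : ∀ t ∈ Icc 0 T, b * abel (1 - α) g t + U t = V t) (hT : 0 < T) :
    ∀ t ≤ T, b * U t = (1 / Real.Gamma α) *
      ∫ x in (0:ℝ)..T, x ^ (α - 1) * (V (t - x) - U (t - x)) := by
  intro t htT
  have hG0 : 0 < Real.Gamma α := Real.Gamma_pos_of_pos h0
  rcases le_or_gt t 0 with ht | ht
  · rw [hU0 t ht, intervalIntegral.integral_congr (g := fun _ => 0)]
    · simp
    · intro x hx
      rw [uIcc_of_le hT.le] at hx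
      simp only
      rw [hU0 _ (by linarith [hx.1]), hV0 _ (by linarith [hx.1])]
      simp
  · rw [conv_eq (Z := fun x => V x - U x) h0 ht.le htT (by fun_prop)
      (fun x hx => by simp [hU0 x hx, hV0 x hx])]
    have hg' : IntervalIntegrable g volume 0 t := hg.mono_set (by
      rw [uIcc_of_le ht.le, uIcc_of_le hT.le]; exact Icc_subset_Icc_right htT)
    have hf := fubini_abel h0 h1 ht hg'
    rw [← hUg t ⟨ht.le, htT⟩] at hf
    have : ∫ s in (0:ℝ)..t, (t - s) ^ (α - 1) * (V s - U s) =
        b * ∫ s in (0:ℝ)..t, (t - s) ^ (α - 1) * abel (1 - α) g s := by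
      rw [← intervalIntegral.integral_const_mul]
      apply intervalIntegral.integral_congr
      intro s hs
      rw [uIcc_of_le ht.le] at hs
      simp only
      rw [← heq s ⟨hs.1, hs.2.trans htT⟩]
      ring
    rw [this, hf]
    field_simp

lemma gron {α b T C : ℝ} (h0 : 0 < α) (hb : 0 < b) (hT : 0 < T) (hC : 0 ≤ C)
    {W : ℝ → ℝ} (hW : Continuous W) (hW0 : ∀ x ≤ 0, W x = 0)
    (h : ∀ t ∈ Icc 0 T, b * |W t| ≤ C + (1 / Real.Gamma α) *
      ∫ x in (0:ℝ)..T, x ^ (α - 1) * |W (t - x)|) :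
    ∀ t ∈ Icc 0 T, |W t| ≤ 2 * C / b * Real.exp ((2 / b) ^ (1 / α) * T) := by
  have hG0 : 0 < Real.Gamma α := Real.Gamma_pos_of_pos h0
  set l := (2 / b) ^ (1 / α) with hl
  have hlpos : 0 < l := Real.rpow_pos_of_pos (by positivity) _
  have hla : (1 / l) ^ α = b / 2 := by
    rw [Real.div_rpow zero_le_one hlpos.le, hl, ← Real.rpow_mul (by positivity)]
    rw [one_div_mul_cancel h0.ne']
    simp
  obtain ⟨t0, ht0, hmax⟩ := isCompact_Icc.exists_isMaxOn (nonempty_Icc.2 hT.le)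
    (show ContinuousOn (fun t => Real.exp (-(l * t)) * |W t|) (Icc 0 T) by fun_prop)
  set N := Real.exp (-(l * t0)) * |W t0| with hN
  have hN0 : 0 ≤ N := by positivity
  have hbd : ∀ t ≤ T, |W t| ≤ N * Real.exp (l * t) := by
    intro t ht
    rcases le_or_gt t 0 with h' | h'
    · rw [hW0 t h', abs_zero]; positivity
    · have := hmax (show t ∈ Icc 0 T from ⟨h'.le, ht⟩)
      simp only [mem_ofPred_eq] at this
      calc |W t| = (Real.exp (-(l * t)) * |W t|) * Real.exp (l * t) := by
            rw [Real.exp_neg]; field_simp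
        _ ≤ _ := by gcongr
  have hint : ∫ x in (0:ℝ)..T, x ^ (α - 1) * Real.exp (-(l * x)) ≤ b / 2 * Real.Gamma α := by
    have e := Real.integral_rpow_mul_exp_neg_mul_Ioi h0 hlpos
    rw [hla] at e
    rw [intervalIntegral.integral_of_le hT.le, ← e]
    refine setIntegral_mono_set ?_ ?_ ?_
    · by_contra hn
      have := integral_undef hn
      rw [e] at this
      have : 0 < b / 2 * Real.Gamma α := by positivity
      linarith
    · refine (ae_restrict_iff' measurableSet_Ioi).2 (Filter.Eventually.of_forall fun s hs => ?_)
      exact mul_nonneg (Real.rpow_nonneg (le_of_lt hs) _) (Real.exp_pos _).le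
    · exact Ioc_subset_Ioi_self.eventuallyLE
  have h2 : ∫ x in (0:ℝ)..T, x ^ (α - 1) * |W (t0 - x)| ≤
      (N * Real.exp (l * t0)) * (b / 2 * Real.Gamma α) := by
    refine le_trans ?_ (mul_le_mul_of_nonneg_left hint (by positivity))
    rw [← intervalIntegral.integral_const_mul]
    refine intervalIntegral.integral_mono_on hT.le (kern_int h0 (by fun_prop))
      ((kern_int h0 (by fun_prop)).const_mul _) fun x hx => ?_
    have := hbd (t0 - x) (by linarith [hx.1, ht0.2])
    have e : Real.exp (l * (t0 - x)) = Real.exp (l * t0) * Real.exp (-(l * x)) := by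
      rw [← Real.exp_add]; congr 1; ring
    rw [e] at this
    calc _ ≤ x ^ (α - 1) * (N * (Real.exp (l * t0) * Real.exp (-(l * x)))) :=
          mul_le_mul_of_nonneg_left this (Real.rpow_nonneg hx.1 _)
      _ = _ := by ring
  have h3 := h t0 ht0
  have h4 : |W t0| = N * Real.exp (l * t0) := by
    rw [hN, Real.exp_neg]; field_simp
  have h5 : (1 / Real.Gamma α) * ∫ x in (0:ℝ)..T, x ^ (α - 1) * |W (t0 - x)| ≤
      N * Real.exp (l * t0) * (b / 2) := by
    calc _ ≤ (1 / Real.Gamma α) * ((N * Real.exp (l * t0)) * (b / 2 * Real.Gamma α)) := by gcongr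
      _ = _ := by field_simp
  rw [h4] at h3
  have h6 : N * Real.exp (l * t0) ≤ 2 * C / b := by
    rw [le_div_iff₀ hb]; nlinarith
  have h7 : N ≤ 2 * C / b := by
    refine le_trans ?_ h6
    exact le_mul_of_one_le_right hN0 (Real.one_le_exp (mul_nonneg hlpos.le ht0.1))
  intro t ht
  refine (hbd t ht.2).trans ?_
  gcongr
  exact ht.2

lemma max_princ {α T t0 : ℝ} (h0 : 0 < α) (h1 : α < 1) {u : ℝ → ℝ} {K : NNReal}
    (hK : LipschitzOnWith K u (Icc 0 T)) (ht : 0 ≤ t0) (htT : t0 ≤ T)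
    (hmax : ∀ s ∈ Icc 0 t0, u s ≤ u t0) : 0 ≤ caputo α u t0 := by
  have hG1 : 0 < Real.Gamma (1 - α) := Real.Gamma_pos_of_pos (by linarith)
  unfold caputo abel
  refine mul_nonneg (by positivity) ?_
  rw [sub_sub_cancel]
  by_cases hi : IntervalIntegrable (fun s => deriv u s / (t0 - s) ^ α) volume 0 t0
  swap
  · rw [intervalIntegral.integral_undef hi]
  rcases ht.eq_or_lt with rfl | htpos
  · simp
  have hcont := intervalIntegral.continuousOn_primitive_interval' hi
    (show (0:ℝ) ∈ uIcc 0 t0 from left_mem_uIcc)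
  have hc := (hcont t0 right_mem_uIcc).mono_left
    (nhdsWithin_mono t0 (show Ioo 0 t0 ⊆ uIcc 0 t0 from by
      rw [uIcc_of_le ht]; exact Ioo_subset_Icc_self))
  have hlim : Filter.Tendsto (fun s => -((K:ℝ) * (t0 - s) ^ (1 - α))) (nhdsWithin t0 (Ioo 0 t0))
      (nhds 0) := by
    have : ContinuousAt (fun s => -((K:ℝ) * (t0 - s) ^ (1 - α))) t0 := by
      refine (ContinuousAt.mul continuousAt_const ?_).neg
      exact (by fun_prop : ContinuousAt (fun s => t0 - s) t0).rpow_const (Or.inr (by linarith))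
    have h := this.tendsto
    simp only [sub_self, Real.zero_rpow (by linarith : (1 - α) ≠ 0), mul_zero, neg_zero] at h
    exact h.mono_left nhdsWithin_le_nhds
  have hne : (nhdsWithin t0 (Ioo 0 t0)).NeBot := by
    rw [nhdsWithin_Ioo_eq_nhdsLT htpos]; infer_instance
  refine le_of_tendsto_of_tendsto hlim hc ?_
  filter_upwards [self_mem_nhdsWithin] with x hx
  have hder : ∀ s ∈ Icc 0 x, HasDerivAt (fun s => (t0 - s) ^ (-α)) (α * (t0 - s) ^ (-α - 1)) s := by
    intro s hs
    have := ((hasDerivAt_id s).const_sub t0).rpow_const (p := -α)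
      (Or.inl (by simp only [id]; linarith [hs.2, hx.2] : t0 - id s ≠ 0) )
    have e : α * (t0 - s) ^ (-α - 1) = -1 * -α * (t0 - id s) ^ (-α - 1) := by simp only [id]; ring
    rw [e]; exact this
  have hac1 : AbsolutelyContinuousOnInterval (fun s => (t0 - s) ^ (-α)) 0 x := by
    apply ContDiffOn.absolutelyContinuousOnInterval
    rw [uIcc_of_le hx.1.le]
    intro s hs
    exact ((contDiff_const.sub contDiff_id).contDiffAt.rpow_const_of_ne
      (by simp only [id]; linarith [hs.2, hx.2])).contDiffWithinAt
  have hac2 : AbsolutelyContinuousOnInterval (fun s => u t0 - u s) 0 x := by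
    have hl : LipschitzOnWith (0 + K) (fun s => u t0 - u s) (uIcc 0 x) := by
      rw [uIcc_of_le hx.1.le]
      exact ((LipschitzWith.const (u t0)).lipschitzOnWith).sub
        (hK.mono (Icc_subset_Icc_right (hx.2.le.trans htT)))
    exact hl.absolutelyContinuousOnInterval
  have hparts := hac1.integral_mul_deriv_eq_deriv_mul hac2
  have e1 : ∫ s in (0:ℝ)..x, (t0 - s) ^ (-α) * deriv (fun s => u t0 - u s) s =
      - ∫ s in (0:ℝ)..x, deriv u s / (t0 - s) ^ α := by
    rw [← intervalIntegral.integral_neg]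
    apply intervalIntegral.integral_congr
    intro s hs
    rw [uIcc_of_le hx.1.le] at hs
    simp only
    rw [deriv_const_sub, Real.rpow_neg (by linarith [hs.2, hx.2])]
    ring
  have e2 : 0 ≤ ∫ s in (0:ℝ)..x, deriv (fun s => (t0 - s) ^ (-α)) s * (u t0 - u s) := by
    refine intervalIntegral.integral_nonneg hx.1.le fun s hs => ?_
    rw [(hder s hs).deriv]
    have := hmax s ⟨hs.1, hs.2.trans hx.2.le⟩
    exact mul_nonneg (mul_nonneg h0.le (Real.rpow_nonneg (by linarith [hs.2, hx.2]) _))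
      (by linarith)
  have e3 : 0 ≤ (t0 - 0) ^ (-α) * (u t0 - u 0) :=
    mul_nonneg (Real.rpow_nonneg (by linarith) _) (by linarith [hmax 0 ⟨le_rfl, ht⟩])
  have e4 : (t0 - x) ^ (-α) * (u t0 - u x) ≤ K * (t0 - x) ^ (1 - α) := by
    have hp : 0 < t0 - x := by linarith [hx.2]
    have := hK.dist_le_mul t0 ⟨ht, htT⟩ x ⟨hx.1.le, hx.2.le.trans htT⟩
    rw [Real.dist_eq, Real.dist_eq, abs_of_pos hp] at this
    have h' := (le_abs_self _).trans this
    calc _ ≤ (t0 - x) ^ (-α) * (K * (t0 - x)) :=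
          mul_le_mul_of_nonneg_left h' (Real.rpow_nonneg hp.le _)
      _ = K * (t0 - x) ^ (1 - α) := by
          rw [sub_eq_add_neg 1 α, Real.rpow_add hp, Real.rpow_one]; ring
  rw [e1] at hparts
  linarith

/-- Extension of a continuous function on `[0,T]` by constants. -/
lemma ext_exists {T : ℝ} (hT : 0 < T) {f : ℝ → ℝ} (hf : ContinuousOn f (Icc 0 T)) (hf0 : f 0 = 0) :
    ∃ F : ℝ → ℝ, Continuous F ∧ (∀ x ≤ 0, F x = 0) ∧ (∀ x ∈ Icc 0 T, F x = f x) ∧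
      ∀ K : NNReal, LipschitzOnWith K f (Icc 0 T) → LipschitzWith K F := by
  refine ⟨fun x => f (projIcc 0 T hT.le x), ?_, ?_, ?_, ?_⟩
  · exact hf.domRestrict.comp continuous_projIcc
  · intro x hx
    simp only
    rw [projIcc_of_le_left hT.le hx]; exact hf0
  · intro x hx
    simp only
    rw [projIcc_of_mem hT.le hx]
  · intro K hK
    have h1 : LipschitzWith 1 (projIcc 0 T hT.le) := LipschitzWith.projIcc hT.le
    have := (lipschitzOnWith_iff_restrict.1 hK).comp h1
    rw [mul_one] at this
    exact this

lemma kern_integral {α T : ℝ} (h0 : 0 < α) (c : ℝ) :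
    ∫ x in (0:ℝ)..T, x ^ (α - 1) * c = T ^ α / α * c := by
  rw [intervalIntegral.integral_mul_const, integral_rpow (Or.inl (by linarith))]
  simp [h0.ne']

lemma lip_of_volterra {α b T : ℝ} (h0 : 0 < α) (hb : 0 < b) (hT : 0 < T) {U V : ℝ → ℝ}
    (hU : Continuous U) (hV : Continuous V)
    (hU0 : ∀ x ≤ 0, U x = 0) {L : NNReal} (hL : LipschitzWith L V)
    (heq : ∀ t ≤ T, b * U t = (1 / Real.Gamma α) *
      ∫ x in (0:ℝ)..T, x ^ (α - 1) * (V (t - x) - U (t - x))) :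
    ∃ K : NNReal, LipschitzOnWith K U (Icc 0 T) := by
  have hG0 : 0 < Real.Gamma α := Real.Gamma_pos_of_pos h0
  set c := 1 / Real.Gamma α with hc
  have hcpos : 0 < c := by positivity
  set D : ℝ := 2 * (c * (T ^ α / α * L)) / b * Real.exp ((2 / b) ^ (1 / α) * T) with hD
  have hD0 : 0 ≤ D := by positivity
  have key : ∀ h ≥ 0, ∀ t ∈ Icc 0 T, |U t - U (t - h)| ≤ D * h := by
    intro h hh t ht
    have := gron (W := fun t => U t - U (t - h)) (C := c * (T ^ α / α * (L * h))) h0 hb hT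
      (by positivity) (by fun_prop)
      (fun x hx => by rw [hU0 x hx, hU0 _ (by linarith), sub_zero]) ?_ t ht
    · refine this.trans (le_of_eq ?_)
      rw [hD]; ring
    intro t ht
    rw [← hc, ← kern_integral h0, ← mul_add, ← intervalIntegral.integral_add
      (kern_int h0 (by fun_prop)) (kern_int h0 (by fun_prop))]
    have e : b * (U t - U (t - h)) = c * ∫ x in (0:ℝ)..T, x ^ (α - 1) *
        ((V (t - x) - V (t - h - x)) - (U (t - x) - U (t - x - h))) := by
      rw [mul_sub, heq t ht.2, heq (t - h) (by linarith [ht.2]), ← mul_sub,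
        ← intervalIntegral.integral_sub
        (kern_int h0 (by fun_prop)) (kern_int h0 (by fun_prop))]
      congr 2
      ext x
      rw [sub_right_comm t h x]; ring
    have e' : b * |U t - U (t - h)| = |b * (U t - U (t - h))| := by
      rw [abs_mul, abs_of_pos hb]
    rw [e', e, abs_mul, abs_of_pos hcpos]
    refine mul_le_mul_of_nonneg_left ?_ hcpos.le
    refine (intervalIntegral.abs_integral_le_integral_abs hT.le).trans ?_
    refine intervalIntegral.integral_mono_on hT.le (kern_int h0 (by fun_prop)).abs
      ((kern_int h0 (by fun_prop)).add (kern_int h0 (by fun_prop))) fun x hx => ?_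
    rw [abs_mul, abs_of_nonneg (Real.rpow_nonneg hx.1 _), ← mul_add]
    refine mul_le_mul_of_nonneg_left ?_ (Real.rpow_nonneg hx.1 _)
    refine (abs_sub _ _).trans ?_
    gcongr
    have := hL.dist_le_mul (t - x) (t - h - x)
    rw [Real.dist_eq, Real.dist_eq] at this
    refine this.trans (le_of_eq ?_)
    congr 1
    rw [show t - x - (t - h - x) = h by ring, abs_of_nonneg hh]
  refine ⟨⟨D, hD0⟩, LipschitzOnWith.of_dist_le_mul ?_⟩
  have key2 : ∀ x ∈ Icc 0 T, ∀ y ∈ Icc 0 T, y ≤ x → |U x - U y| ≤ D * |x - y| := by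
    intro x hx y hy hyx
    have := key (x - y) (by linarith) x hx
    rwa [sub_sub_cancel, ← abs_of_nonneg (sub_nonneg.2 hyx)] at this
  intro x hx y hy
  rw [Real.dist_eq, Real.dist_eq]
  rcases le_total y x with h | h
  · exact key2 x hx y hy h
  · rw [abs_sub_comm, abs_sub_comm x y]; exact key2 y hy x hx h

lemma caputo_zero (α : ℝ) (u : ℝ → ℝ) : caputo α u 0 = 0 := by simp [caputo, abel]

lemma cont_of_reg {T : ℝ} (hT : 0 < T) {u : ℝ → ℝ} (hu0 : u 0 = 0)
    (hureg : ∀ t ∈ Set.Icc (0:ℝ) T, u t = u 0 + ∫ s in (0:ℝ)..t, deriv u s)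
    (huint : IntervalIntegrable (deriv u) volume 0 T) : ContinuousOn u (Icc 0 T) := by
  have h := intervalIntegral.continuousOn_primitive_interval' huint
    (show (0:ℝ) ∈ uIcc 0 T from left_mem_uIcc)
  rw [uIcc_of_le hT.le] at h
  refine h.congr fun t ht => ?_
  rw [hureg t ht, hu0, zero_add]

lemma sup_bound {α b T : ℝ} (h0 : 0 < α) (h1 : α < 1) (hb : 0 < b) {u : ℝ → ℝ} (hu0 : u 0 = 0)
    {K : NNReal} (hK : LipschitzOnWith K u (Icc 0 T)) {t : ℝ} (ht : t ∈ Icc 0 T) {M : ℝ}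
    (hM : ∀ r ∈ Icc 0 t, b * caputo α u r + u r ≤ M) : ∀ s ∈ Icc 0 t, u s ≤ M := by
  intro s hs
  obtain ⟨t0, ht0, hmax⟩ := isCompact_Icc.exists_isMaxOn (nonempty_Icc.2 ht.1)
    (hK.continuousOn.mono (Icc_subset_Icc_right ht.2))
  have hc := max_princ h0 h1 hK ht0.1 (ht0.2.trans ht.2)
    (fun r hr => hmax (show r ∈ Icc 0 t from ⟨hr.1, hr.2.trans ht0.2⟩))
  have h2 := hM t0 ht0
  have h3 : u s ≤ u t0 := hmax hs
  have := mul_nonneg hb.le hc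
  linarith

lemma caputo_neg (α : ℝ) (u : ℝ → ℝ) (t : ℝ) : caputo α (fun s => - u s) t = - caputo α u t := by
  simp only [caputo, abel, deriv.fun_neg, neg_div, intervalIntegral.integral_neg, mul_neg]

/-- Fractional relaxation ODE: if `ũ := b₂ ∂_t^α u + u ∈ W^{1,∞}(0,T)` and
`u(0) = 0`, then `u` is uniquely determined by `ũ`, `u ∈ W^{1,∞}(0,T)`, and the
solution map is bounded on `L^∞`: `‖u‖_{L^∞(0,t)} ≤ ‖ũ‖_{L^∞(0,t)}`. -/
theorem fractional_relaxation_ode (α b₂ T : ℝ) (hα : α ∈ Set.Ioo (0:ℝ) 1)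
    (hb : 0 < b₂) (hT : 0 < T)
    (u : ℝ → ℝ) (hu0 : u 0 = 0)
    (hureg : ∀ t ∈ Set.Icc (0:ℝ) T, u t = u 0 + ∫ s in (0:ℝ)..t, deriv u s)
    (huint : IntervalIntegrable (deriv u) volume 0 T)
    (hLip : ∃ K : NNReal,
      LipschitzOnWith K (fun t => b₂ * caputo α u t + u t) (Set.Icc 0 T)) :
    (∃ K : NNReal, LipschitzOnWith K u (Set.Icc 0 T)) ∧
    (∀ t ∈ Set.Icc (0:ℝ) T, ∀ s ∈ Set.Icc (0:ℝ) t,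
      |u s| ≤ sSup ((fun r => |b₂ * caputo α u r + u r|) '' Set.Icc (0:ℝ) t)) ∧
    (∀ u₂ : ℝ → ℝ, u₂ 0 = 0 →
      (∀ t ∈ Set.Icc (0:ℝ) T, u₂ t = u₂ 0 + ∫ s in (0:ℝ)..t, deriv u₂ s) →
      IntervalIntegrable (deriv u₂) volume 0 T →
      (∀ t ∈ Set.Icc (0:ℝ) T,
        b₂ * caputo α u₂ t + u₂ t = b₂ * caputo α u t + u t) →
      ∀ t ∈ Set.Icc (0:ℝ) T, u₂ t = u t) := by
  obtain ⟨h0, h1⟩ := hα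
  obtain ⟨L, hL⟩ := hLip
  have hucont := cont_of_reg hT hu0 hureg huint
  obtain ⟨V, hVc, hV0, hVeq, hVL⟩ := ext_exists hT hL.continuousOn
    (by simp [caputo_zero, hu0])
  have vol : ∀ w : ℝ → ℝ, w 0 = 0 →
      (∀ t ∈ Set.Icc (0:ℝ) T, w t = w 0 + ∫ s in (0:ℝ)..t, deriv w s) →
      IntervalIntegrable (deriv w) volume 0 T →
      (∀ t ∈ Set.Icc (0:ℝ) T,
        b₂ * caputo α w t + w t = b₂ * caputo α u t + u t) →
      ∃ W : ℝ → ℝ, Continuous W ∧ (∀ x ≤ 0, W x = 0) ∧ (∀ x ∈ Icc 0 T, W x = w x) ∧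
        ∀ t ≤ T, b₂ * W t = (1 / Real.Gamma α) *
          ∫ x in (0:ℝ)..T, x ^ (α - 1) * (V (t - x) - W (t - x)) := by
    intro w hw0 hwreg hwint hweq
    obtain ⟨W, hWc, hW0, hWeq, -⟩ := ext_exists hT (cont_of_reg hT hw0 hwreg hwint) hw0
    refine ⟨W, hWc, hW0, hWeq, volterra h0 h1 hwint hWc hVc hW0 hV0 ?_ ?_ hT⟩
    · intro t ht
      rw [hWeq t ht, hwreg t ht, hw0, zero_add]
    · intro t ht
      rw [hWeq t ht, hVeq t ht]
      exact hweq t ht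
  obtain ⟨U, hUc, hU0, hUeq, hUvol⟩ := vol u hu0 hureg huint (fun _ _ => rfl)
  have hlip : ∃ K : NNReal, LipschitzOnWith K u (Set.Icc 0 T) := by
    obtain ⟨K, hK⟩ := lip_of_volterra h0 hb hT hUc hVc hU0 (hVL L hL) hUvol
    refine ⟨K, fun x hx y hy => ?_⟩
    rw [← hUeq x hx, ← hUeq y hy]
    exact hK hx hy
  refine ⟨hlip, ?_, ?_⟩
  · obtain ⟨K, hK⟩ := hlip
    intro t ht s hs
    have hbdd : BddAbove ((fun r => |b₂ * caputo α u r + u r|) '' Set.Icc (0:ℝ) t) :=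
      isCompact_Icc.bddAbove_image
        (hL.continuousOn.mono (Icc_subset_Icc_right ht.2)).abs
    have hle : ∀ r ∈ Icc 0 t, |b₂ * caputo α u r + u r| ≤
        sSup ((fun r => |b₂ * caputo α u r + u r|) '' Set.Icc (0:ℝ) t) :=
      fun r hr => le_csSup hbdd (mem_image_of_mem _ hr)
    refine abs_le'.2 ⟨?_, ?_⟩
    · exact sup_bound h0 h1 hb hu0 hK ht (fun r hr => (le_abs_self _).trans (hle r hr)) s hs
    · have hK' : LipschitzOnWith K (fun s => - u s) (Icc 0 T) := hK.neg
      refine sup_bound (u := fun s => - u s) h0 h1 hb (by simp [hu0]) hK' ht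
        (fun r hr => ?_) s hs
      rw [caputo_neg]
      refine le_trans (le_of_eq ?_) ((neg_le_abs _).trans (hle r hr))
      ring
  · intro u₂ h20 h2reg h2int h2eq t ht
    obtain ⟨W, hWc, hW0, hWeq, hWvol⟩ := vol u₂ h20 h2reg h2int h2eq
    have := gron (W := fun t => W t - U t) (C := 0) h0 hb hT le_rfl (by fun_prop)
      (fun x hx => by rw [hW0 x hx, hU0 x hx, sub_zero]) ?_ t ht
    · simp only [mul_zero, zero_div, zero_mul] at this
      have h := abs_nonpos_iff.1 this
      rw [← hWeq t ht, ← hUeq t ht]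
      linarith
    · intro t ht
      have hG0 : 0 < Real.Gamma α := Real.Gamma_pos_of_pos h0
      have e : b₂ * (W t - U t) = (1 / Real.Gamma α) * ∫ x in (0:ℝ)..T, x ^ (α - 1) *
          (U (t - x) - W (t - x)) := by
        rw [mul_sub, hWvol t ht.2, hUvol t ht.2, ← mul_sub, ← intervalIntegral.integral_sub
          (kern_int h0 (by fun_prop)) (kern_int h0 (by fun_prop))]
        congr 2
        ext x
        ring
      have e' : b₂ * |W t - U t| = |b₂ * (W t - U t)| := by
        rw [abs_mul, abs_of_pos hb]
      rw [e', e, abs_mul, abs_of_pos (by positivity), zero_add]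
      refine mul_le_mul_of_nonneg_left ?_ (by positivity)
      refine (intervalIntegral.abs_integral_le_integral_abs hT.le).trans ?_
      refine intervalIntegral.integral_mono_on hT.le (kern_int h0 (by fun_prop)).abs
        (kern_int h0 (by fun_prop)) fun x hx => ?_
      rw [abs_mul, abs_of_nonneg (Real.rpow_nonneg hx.1 _), abs_sub_comm]
end

section
/- Let α ∈ (0,1), b₂ > 0, and w ∈ W^{1,∞}(0,T) with w(0) = 0 and (∂_t^α w)² ∈ W^{1,1}(0,T). Then ∫₀ᵗ (∂_t^α w)(s) · (b₂ ∂_t^α w + w)_t(s) ds ≥ (b₂/2) |∂_t^α w(t)|² + (1/(2Γ(α) t^{1-α})) ‖∂_t^α w‖²_{L²(0,t)}. -/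
open MeasureTheory intervalIntegral Set

/-- one-sided power kernel -/
noncomputable def kerL (γ r : ℝ) : ℝ := if 0 < r then r ^ (γ - 1) else 0

/-- unnormalised Abel operator -/
noncomputable def opA (γ : ℝ) (v : ℝ → ℝ) (s : ℝ) : ℝ :=
  ∫ x in (0:ℝ)..s, kerL γ (s - x) * v x

lemma kerL_nonneg (γ r : ℝ) : 0 ≤ kerL γ r := by
  unfold kerL; split_ifs with h
  · positivity
  · exact le_rfl

lemma kerL_of_pos {γ r : ℝ} (h : 0 < r) : kerL γ r = r ^ (γ - 1) := if_pos h

lemma kerL_of_nonpos {γ r : ℝ} (h : r ≤ 0) : kerL γ r = 0 := if_neg (not_lt.2 h)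

@[fun_prop]
lemma kerL_meas (γ : ℝ) : Measurable (kerL γ) :=
  Measurable.ite measurableSet_Ioi (by fun_prop) (by fun_prop)

lemma kerL_anti {γ r s : ℝ} (hγ : γ ≤ 1) (hr : 0 < r) (h : r ≤ s) : kerL γ s ≤ kerL γ r := by
  rw [kerL_of_pos hr, kerL_of_pos (hr.trans_le h)]
  exact Real.rpow_le_rpow_of_nonpos hr h (by linarith)

lemma kerL_int {γ : ℝ} (hγ : 0 < γ) (a b : ℝ) : IntervalIntegrable (kerL γ) volume a b := by
  have h := intervalIntegrable_rpow' (a := a) (b := b) (r := γ - 1) (by linarith)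
  refine h.mono_fun (kerL_meas γ).aestronglyMeasurable (Filter.Eventually.of_forall fun x => ?_)
  simp only [kerL]; split_ifs <;> simp

lemma kerL_int_sub {γ : ℝ} (hγ : 0 < γ) (c a b : ℝ) :
    IntervalIntegrable (fun x => kerL γ (c - x)) volume a b := by
  have := (kerL_int hγ (c - a) (c - b)).comp_sub_left c
  simpa using this

lemma kerL_mul_int {γ : ℝ} (hγ : 0 < γ) (c : ℝ) {a b M : ℝ} (hab : a ≤ b) {v : ℝ → ℝ}
    (hv : Measurable v) (hM : ∀ x ∈ Ioc a b, |v x| ≤ M) :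
    IntervalIntegrable (fun x => kerL γ (c - x) * v x) volume a b := by
  rw [intervalIntegrable_iff_integrableOn_Ioc_of_le hab]
  have h := (intervalIntegrable_iff_integrableOn_Ioc_of_le hab).1 (kerL_int_sub hγ c a b)
  refine Integrable.mul_bdd (c := M) h hv.aestronglyMeasurable ?_
  exact (ae_restrict_iff' measurableSet_Ioc).2 (Filter.Eventually.of_forall fun x hx => hM x hx)

lemma kerL_integral {γ : ℝ} (hγ : 0 < γ) {a b c : ℝ} (hab : a ≤ b) (hbc : b ≤ c) :
    ∫ x in a..b, kerL γ (c - x) = ((c - a) ^ γ - (c - b) ^ γ) / γ := by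
  rw [intervalIntegral.integral_comp_sub_left (fun x => kerL γ x) c]
  have : ∫ x in (c-b)..(c-a), kerL γ x = ∫ x in (c-b)..(c-a), x ^ (γ - 1) := by
    apply intervalIntegral.integral_congr_ae
    refine Filter.Eventually.of_forall fun x hx => ?_
    rw [uIoc_of_le (by linarith)] at hx
    exact kerL_of_pos (by linarith [hx.1])
  rw [this, integral_rpow (Or.inl (by linarith))]
  simp

lemma opA_nonpos {γ : ℝ} {v : ℝ → ℝ} {s : ℝ} (hs : s ≤ 0) : opA γ v s = 0 := by
  unfold opA
  apply intervalIntegral.integral_zero_ae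
  refine Filter.Eventually.of_forall fun x hx => ?_
  rw [uIoc_of_ge hs] at hx
  rw [kerL_of_nonpos (by linarith [hx.1]), zero_mul]

/-- extension of the domain of integration -/
lemma opA_eq {γ : ℝ} (hγ : 0 < γ) {v : ℝ → ℝ} {s S M : ℝ} (hs : s ≤ S) (hS : 0 ≤ S)
    (hv : Measurable v) (hM : ∀ x ∈ Ioc 0 S, |v x| ≤ M) :
    opA γ v s = ∫ x in (0:ℝ)..S, kerL γ (s - x) * v x := by
  rcases le_total s 0 with h0 | h0
  · rw [opA_nonpos h0]
    symm
    apply intervalIntegral.integral_zero_ae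
    refine Filter.Eventually.of_forall fun x hx => ?_
    rw [uIoc_of_le hS] at hx
    rw [kerL_of_nonpos (by linarith [hx.1]), zero_mul]
  · rw [← intervalIntegral.integral_add_adjacent_intervals (b := s)
      (kerL_mul_int hγ s h0 hv (fun x hx => hM x ⟨hx.1, hx.2.trans hs⟩))
      (kerL_mul_int hγ s hs hv (fun x hx => hM x ⟨h0.trans_lt hx.1, hx.2⟩))]
    rw [intervalIntegral.integral_zero_ae (a := s), add_zero, opA]
    refine Filter.Eventually.of_forall fun x hx => ?_
    rw [uIoc_of_le hs] at hx
    rw [kerL_of_nonpos (by linarith [hx.1]), zero_mul]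

lemma int_mul_bound {a b M : ℝ} (hab : a ≤ b) {g v : ℝ → ℝ} (hg : ∀ x ∈ Ioo a b, 0 ≤ g x)
    (hgi : IntervalIntegrable g volume a b) (hM : ∀ x ∈ Ioc a b, |v x| ≤ M) :
    |∫ x in a..b, g x * v x| ≤ M * ∫ x in a..b, g x := by
  rw [← intervalIntegral.integral_const_mul, ← Real.norm_eq_abs]
  refine intervalIntegral.norm_integral_le_of_norm_le hab ?_ (hgi.const_mul M)
  have hb : ∀ᵐ x : ℝ, x ≠ b := by simp [ae_iff, measure_singleton]
  filter_upwards [hb] with x hx hx'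
  rw [Real.norm_eq_abs, abs_mul, abs_of_nonneg (hg x ⟨hx'.1, lt_of_le_of_ne hx'.2 hx⟩), mul_comm]
  exact mul_le_mul_of_nonneg_right (hM x hx') (hg x ⟨hx'.1, lt_of_le_of_ne hx'.2 hx⟩)

lemma opA_holder {γ : ℝ} (hγ : 0 < γ) (hγ1 : γ ≤ 1) {v : ℝ → ℝ} {S M : ℝ} (hM0 : 0 ≤ M)
    (hv : Measurable v) (hM : ∀ x ∈ Ioc 0 S, |v x| ≤ M) {x y : ℝ} (hxy : x ≤ y) (hy : y ≤ S) :
    |opA γ v y - opA γ v x| ≤ (2 * M / γ) * (y - x) ^ γ := by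
  have key : ∀ x y : ℝ, 0 ≤ x → x ≤ y → y ≤ S →
      |opA γ v y - opA γ v x| ≤ (2 * M / γ) * (y - x) ^ γ := by
    intro x y hx hxy hy
    have i1 := kerL_mul_int (γ := γ) hγ y hx hv (fun z hz => hM z ⟨hz.1, hz.2.trans (hxy.trans hy)⟩)
    have i2 := kerL_mul_int (γ := γ) hγ y hxy hv
      (fun z hz => hM z ⟨hx.trans_lt hz.1, hz.2.trans hy⟩)
    have i3 := kerL_mul_int (γ := γ) hγ x hx hv (fun z hz => hM z ⟨hz.1, hz.2.trans (hxy.trans hy)⟩)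
    have e : opA γ v y - opA γ v x = (∫ z in x..y, kerL γ (y - z) * v z)
        - ∫ z in (0:ℝ)..x, (kerL γ (x - z) - kerL γ (y - z)) * v z := by
      simp only [sub_mul]
      rw [intervalIntegral.integral_sub i3 i1, opA, opA,
        ← intervalIntegral.integral_add_adjacent_intervals i1 i2]
      ring
    have b1 := int_mul_bound (g := fun z => kerL γ (y - z)) hxy (fun z _ => kerL_nonneg _ _)
      (kerL_int_sub hγ y x y) (fun z hz => hM z ⟨hx.trans_lt hz.1, hz.2.trans hy⟩)
    have b2 := int_mul_bound (g := fun z => kerL γ (x - z) - kerL γ (y - z)) hx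
      (fun z hz => sub_nonneg.2 (kerL_anti hγ1 (by linarith [hz.2]) (by linarith)))
      ((kerL_int_sub hγ x 0 x).sub (kerL_int_sub hγ y 0 x))
      (fun z hz => hM z ⟨hz.1, hz.2.trans (hxy.trans hy)⟩)
    rw [intervalIntegral.integral_sub (kerL_int_sub hγ x 0 x) (kerL_int_sub hγ y 0 x),
      kerL_integral hγ hx le_rfl, kerL_integral hγ hx hxy] at b2
    rw [kerL_integral hγ hxy le_rfl] at b1
    simp only [sub_self, sub_zero, Real.zero_rpow hγ.ne'] at b1 b2
    have mono : x ^ γ ≤ y ^ γ := Real.rpow_le_rpow hx hxy hγ.le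
    have : x ^ γ / γ - (y ^ γ - (y - x) ^ γ) / γ ≤ (y - x) ^ γ / γ := by
      rw [← sub_div]
      apply div_le_div_of_nonneg_right _ hγ.le
      linarith
    have := mul_le_mul_of_nonneg_left this hM0
    rw [e]
    refine (abs_sub _ _).trans ?_
    calc _ ≤ M * ((y - x) ^ γ / γ) + M * ((y - x) ^ γ / γ) := add_le_add b1 (b2.trans this)
      _ = _ := by ring
  rcases le_total y 0 with h0 | h0
  · rw [opA_nonpos h0, opA_nonpos (hxy.trans h0)]
    simp only [sub_self, abs_zero]
    have : 0 ≤ y - x := by linarith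
    positivity
  rcases le_total 0 x with h1 | h1
  · exact key x y h1 hxy hy
  · have := key 0 y le_rfl h0 hy
    rw [opA_nonpos h1, ← opA_nonpos (γ := γ) (v := v) (le_refl (0:ℝ))]
    refine this.trans ?_
    gcongr

lemma opA_cont {γ : ℝ} (hγ : 0 < γ) (hγ1 : γ ≤ 1) {v : ℝ → ℝ} {S M : ℝ} (hM0 : 0 ≤ M)
    (hv : Measurable v) (hM : ∀ x ∈ Ioc 0 S, |v x| ≤ M) : ContinuousOn (opA γ v) (Iic S) := by
  intro x hx
  rw [ContinuousWithinAt, tendsto_iff_norm_sub_tendsto_zero]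
  have : Filter.Tendsto (fun y => (2 * M / γ) * |y - x| ^ γ) (nhdsWithin x (Iic S)) (nhds 0) := by
    have hc : Continuous fun y : ℝ => (2 * M / γ) * |y - x| ^ γ := by
      have : Continuous fun y : ℝ => |y - x| ^ γ :=
        Continuous.rpow_const (by fun_prop) (fun _ => Or.inr hγ.le)
      fun_prop
    have := (hc.tendsto x).mono_left (nhdsWithin_le_nhds (s := Iic S))
    simpa [Real.zero_rpow hγ.ne'] using this
  refine squeeze_zero' (Filter.Eventually.of_forall fun _ => norm_nonneg _) ?_ this
  filter_upwards [self_mem_nhdsWithin] with y hy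
  rw [Real.norm_eq_abs]
  rcases le_total x y with h | h
  · rw [abs_of_nonneg (sub_nonneg.2 h)]
    exact opA_holder hγ hγ1 hM0 hv hM h hy
  · rw [abs_sub_comm, abs_sub_comm y, abs_of_nonneg (sub_nonneg.2 h)]
    exact opA_holder hγ hγ1 hM0 hv hM h hx

lemma beta_real {α : ℝ} (h0 : 0 < α) (h1 : α < 1) {a : ℝ} (ha : 0 < a) :
    ∫ x in (0:ℝ)..a, x ^ ((1 - α) - 1) * (a - x) ^ (α - 1)
      = Real.Gamma α * Real.Gamma (1 - α) := by
  have h := Complex.betaIntegral_scaled ((1 - α : ℝ) : ℂ) (α : ℂ) ha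
  have h2 := Complex.Gamma_mul_Gamma_eq_betaIntegral (s := ((1 - α : ℝ) : ℂ)) (t := (α : ℂ))
    (by simpa using h1) (by simpa using h0)
  have e : ((1 - α : ℝ) : ℂ) + (α : ℂ) = 1 := by push_cast; ring
  rw [e, Complex.Gamma_one, one_mul, Complex.Gamma_ofReal, Complex.Gamma_ofReal] at h2
  rw [e, sub_self, Complex.cpow_zero, one_mul, ← h2] at h
  have h3 : ∫ x in (0:ℝ)..a, ((x ^ ((1 - α) - 1) * (a - x) ^ (α - 1) : ℝ) : ℂ)
      = ∫ x in (0:ℝ)..a, (x : ℂ) ^ (((1 - α : ℝ) : ℂ) - 1) * ((a : ℂ) - x) ^ ((α : ℂ) - 1) := by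
    apply intervalIntegral.integral_congr
    intro x hx
    rw [uIcc_of_le ha.le] at hx
    simp only
    rw [Complex.ofReal_mul, Complex.ofReal_cpow hx.1, Complex.ofReal_cpow (by linarith [hx.2])]
    push_cast; ring_nf
  rw [h, intervalIntegral.integral_ofReal] at h3
  rw [mul_comm]
  exact_mod_cast h3

lemma kerL_beta {α : ℝ} (h0 : 0 < α) (h1 : α < 1) {s z : ℝ} (hz : z < s) :
    ∫ x, kerL α (s - x) * kerL (1 - α) (x - z) = Real.Gamma α * Real.Gamma (1 - α) := by
  rw [← beta_real h0 h1 (a := s - z) (by linarith)]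
  rw [← MeasureTheory.integral_add_right_eq_self _ z,
    intervalIntegral.integral_of_le (by linarith), integral_Ioc_eq_integral_Ioo,
    ← MeasureTheory.integral_indicator measurableSet_Ioo]
  congr 1
  ext x
  by_cases hx : x ∈ Ioo 0 (s - z)
  · rw [indicator_of_mem hx, kerL_of_pos (by linarith [hx.2]), kerL_of_pos (by linarith [hx.1]),
      mul_comm]
    congr 2 <;> ring
  · rw [indicator_of_notMem hx]
    rw [mem_Ioo, not_and_or, not_lt, not_lt] at hx
    rcases hx with hx | hx
    · rw [kerL_of_nonpos (r := x + z - z) (by linarith), mul_zero]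
    · rw [kerL_of_nonpos (r := s - _) (by linarith), zero_mul]

lemma abel_inv {α : ℝ} (h0 : 0 < α) (h1 : α < 1) {u : ℝ → ℝ} {M s : ℝ} (hs : 0 ≤ s)
    (hu : Measurable u) (hM : ∀ x ∈ Ioc 0 s, |u x| ≤ M) :
    opA α (opA (1 - α) u) s = Real.Gamma α * Real.Gamma (1 - α) * ∫ z in (0:ℝ)..s, u z := by
  have hB : 0 < Real.Gamma α * Real.Gamma (1 - α) :=
    mul_pos (Real.Gamma_pos_of_pos h0) (Real.Gamma_pos_of_pos (by linarith))
  set B := Real.Gamma α * Real.Gamma (1 - α) with hBdef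
  have hns : ∀ᵐ z : ℝ, z ≠ s := by simp [ae_iff, measure_singleton]
  have hui : IntegrableOn u (Ioc 0 s) :=
    Measure.integrableOn_of_bounded (M := M) (by simp) hu.aestronglyMeasurable
      ((ae_restrict_iff' measurableSet_Ioc).2 (Filter.Eventually.of_forall fun x hx => hM x hx))
  have hFub : Integrable (Function.uncurry fun x z : ℝ =>
      kerL α (s - x) * kerL (1 - α) (x - z) * u z) (volume.prod (volume.restrict (Ioc 0 s))) := by
    rw [integrable_prod_iff' (by unfold Function.uncurry; fun_prop)]
    simp only [Function.uncurry]
    constructor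
    · rw [ae_restrict_iff' measurableSet_Ioc]
      filter_upwards [hns] with z hz hz'
      have := kerL_beta h0 h1 (lt_of_le_of_ne hz'.2 hz)
      refine Integrable.mul_const ?_ _
      by_contra hcon
      rw [integral_undef hcon] at this
      exact hB.ne this
    · refine (hui.norm.const_mul B).congr ?_
      rw [Filter.EventuallyEq, ae_restrict_iff' measurableSet_Ioc]
      filter_upwards [hns] with z hz hz'
      have := kerL_beta h0 h1 (lt_of_le_of_ne hz'.2 hz)
      simp only [norm_mul, Real.norm_of_nonneg (kerL_nonneg _ _)]
      rw [MeasureTheory.integral_mul_const, this]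
  have hsw := integral_integral_swap hFub
  have e2 : ∫ z in Ioc 0 s, ∫ x, kerL α (s - x) * kerL (1 - α) (x - z) * u z
      = B * ∫ z in (0:ℝ)..s, u z := by
    rw [intervalIntegral.integral_of_le hs, ← MeasureTheory.integral_const_mul]
    apply MeasureTheory.integral_congr_ae
    rw [Filter.EventuallyEq, ae_restrict_iff' measurableSet_Ioc]
    filter_upwards [hns] with z hz hz'
    rw [MeasureTheory.integral_mul_const, kerL_beta h0 h1 (lt_of_le_of_ne hz'.2 hz)]
  rw [← e2, ← hsw, opA, intervalIntegral.integral_of_le hs,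
    ← MeasureTheory.integral_indicator measurableSet_Ioc]
  congr 1
  ext x
  simp only [mul_assoc]
  rw [MeasureTheory.integral_const_mul]
  by_cases hx : x ∈ Ioc 0 s
  · rw [indicator_of_mem hx, opA_eq (by linarith) hx.2 hs hu hM, intervalIntegral.integral_of_le hs]
  · rw [indicator_of_notMem hx]
    rw [mem_Ioc, not_and_or, not_lt, not_le] at hx
    symm
    rcases hx with hx | hx
    · rw [MeasureTheory.setIntegral_eq_zero_of_forall_eq_zero, mul_zero]
      intro z hz
      rw [kerL_of_nonpos (by linarith [hz.1]), zero_mul]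
    · rw [kerL_of_nonpos (by linarith), zero_mul]

lemma core_ptwise {α C h S : ℝ} (hα0 : 0 < α) (hα1 : α < 1) (hh : 0 < h) {F : ℝ → ℝ}
    (hF : Continuous F)
    (hC : ∀ x y, 0 ≤ x → x ≤ y → y ≤ S → |F y - F x| ≤ C * (y - x) ^ (1 - α))
    {s : ℝ} (hs : 0 ≤ s) (hsS : s ≤ S) :
    (1 / 2) * (opA α (fun x => F x ^ 2) s - opA α (fun x => F x ^ 2) (s - h))
      - (1 / 2) * (C ^ 2 * h ^ (1 - α) * h) ≤ F s * (opA α F s - opA α F (s - h)) := by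
  obtain ⟨M, hM⟩ := isCompact_Icc.exists_bound_of_continuousOn (hF.continuousOn (s := Icc 0 s))
  have hM1 : ∀ x ∈ Ioc 0 s, |F x| ≤ M := fun x hx => hM x ⟨hx.1.le, hx.2⟩
  have hM2 : ∀ x ∈ Ioc 0 s, |F x ^ 2| ≤ M ^ 2 := fun x hx => by
    rw [abs_pow]; exact pow_le_pow_left₀ (abs_nonneg _) (hM1 x hx) 2
  have hm := hF.measurable
  have hm2 : Measurable fun x => F x ^ 2 := by fun_prop
  rw [opA_eq hα0 le_rfl hs hm2 hM2, opA_eq hα0 (by linarith) hs hm2 hM2,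
    opA_eq hα0 le_rfl hs hm hM1, opA_eq hα0 (by linarith) hs hm hM1]
  have i1 := kerL_mul_int hα0 s hs hm hM1
  have i2 := kerL_mul_int hα0 (s - h) hs hm hM1
  have j1 := kerL_mul_int hα0 s hs hm2 hM2
  have j2 := kerL_mul_int hα0 (s - h) hs hm2 hM2
  have k1 := kerL_int_sub hα0 s 0 s
  have k2 := kerL_int_sub hα0 (s - h) 0 s
  -- the kernel difference has nonnegative integral
  have kpos : 0 ≤ (∫ x in (0:ℝ)..s, kerL α (s - x)) - ∫ x in (0:ℝ)..s, kerL α (s - h - x) := by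
    have e1 := kerL_integral (c := s) hα0 hs le_rfl
    have e2 : ∫ x in (0:ℝ)..s, kerL α (s - h - x) = opA α (fun _ => 1) (s - h) := by
      rw [opA_eq (M := 1) (S := s) hα0 (by linarith) hs (by fun_prop) (by simp)]
      simp
    rw [e1, e2]
    simp only [sub_zero, sub_self, Real.zero_rpow hα0.ne']
    rcases le_total (s - h) 0 with h0 | h0
    · rw [opA_nonpos h0]
      simp only [sub_zero]
      positivity
    · have e3 := kerL_integral (c := s - h) hα0 h0 le_rfl
      simp only [opA, mul_one]
      rw [e3]
      simp only [sub_zero, sub_self, Real.zero_rpow hα0.ne']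
      rw [← sub_div]
      apply div_nonneg _ hα0.le
      linarith [Real.rpow_le_rpow h0 (show s - h ≤ s by linarith) hα0.le]
  -- error term
  set D := C ^ 2 * h ^ (1 - α) with hD
  have hD0 : 0 ≤ D := by positivity
  have ie : Integrable ((Icc (s - h) s).indicator fun _ => D) :=
    (integrable_indicator_iff measurableSet_Icc).2 (by simp)
  have ei : ∫ x in (0:ℝ)..s, (Icc (s - h) s).indicator (fun _ => D) x ≤ D * h := by
    rw [intervalIntegral.integral_of_le hs]
    refine (setIntegral_le_integral ie (Filter.Eventually.of_forall fun x =>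
      indicator_nonneg (fun _ _ => hD0) x)).trans ?_
    rw [MeasureTheory.integral_indicator measurableSet_Icc]
    simp [Measure.real, hh.le, mul_comm]
  have main : ∫ x in (0:ℝ)..s, ((1 / 2) * F s ^ 2 * (kerL α (s - x) - kerL α (s - h - x))
        + (1 / 2) * (kerL α (s - x) * F x ^ 2 - kerL α (s - h - x) * F x ^ 2)
        - (1 / 2) * (Icc (s - h) s).indicator (fun _ => D) x)
      ≤ ∫ x in (0:ℝ)..s, F s * (kerL α (s - x) * F x - kerL α (s - h - x) * F x) := by
    refine intervalIntegral.integral_mono_on_of_le_Ioo hs ?_ ?_ ?_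
    · exact (((k1.sub k2).const_mul _).add ((j1.sub j2).const_mul _)).sub
        (ie.intervalIntegrable.const_mul _)
    · exact (i1.sub i2).const_mul _
    · intro x hx
      have hr : 0 < s - x := by linarith [hx.2]
      rcases le_or_gt (s - x) h with hrh | hrh
      · rw [kerL_of_nonpos (r := s - h - x) (by linarith),
          indicator_of_mem (show x ∈ Icc (s - h) s from ⟨by linarith, hx.2.le⟩)]
        have hL := kerL_nonneg α (s - x)
        have hb := hC x s hx.1.le hx.2.le hsS
        have : kerL α (s - x) * (F s - F x) ^ 2 ≤ D := by
          calc kerL α (s - x) * (F s - F x) ^ 2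
              ≤ kerL α (s - x) * (C * (s - x) ^ (1 - α)) ^ 2 := by
                apply mul_le_mul_of_nonneg_left _ hL
                rw [← sq_abs]; exact pow_le_pow_left₀ (abs_nonneg _) hb 2
            _ = C ^ 2 * (s - x) ^ (1 - α) := by
                have : (s - x) ^ (α - 1) * (s - x) ^ (1 - α) = 1 := by
                  rw [← Real.rpow_add hr]; simp
                rw [kerL_of_pos hr]
                linear_combination C ^ 2 * (s - x) ^ (1 - α) * this
            _ ≤ D := by
                rw [hD]
                apply mul_le_mul_of_nonneg_left _ (sq_nonneg C)
                exact Real.rpow_le_rpow hr.le hrh (by linarith)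
        nlinarith
      · have hL := kerL_anti hα1.le (show 0 < s - h - x by linarith)
          (show s - h - x ≤ s - x by linarith)
        have hi : 0 ≤ (Icc (s - h) s).indicator (fun _ => D) x :=
          indicator_nonneg (fun _ _ => hD0) x
        nlinarith [mul_nonneg (sub_nonneg.2 hL) (sq_nonneg (F s - F x))]
  rw [intervalIntegral.integral_sub (((k1.sub k2).const_mul _).add ((j1.sub j2).const_mul _))
        (ie.intervalIntegrable.const_mul _),
    intervalIntegral.integral_add ((k1.sub k2).const_mul _) ((j1.sub j2).const_mul _),
    intervalIntegral.integral_const_mul, intervalIntegral.integral_const_mul,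
    intervalIntegral.integral_const_mul, intervalIntegral.integral_const_mul,
    intervalIntegral.integral_sub k1 k2, intervalIntegral.integral_sub j1 j2,
    intervalIntegral.integral_sub i1 i2] at main
  have := mul_nonneg (show 0 ≤ (1 / 2) * F s ^ 2 by positivity) kpos
  linarith

lemma core {α K t : ℝ} (hα0 : 0 < α) (hα1 : α < 1) (ht : 0 < t) (hK : 0 ≤ K) {u : ℝ → ℝ}
    (hu : Measurable u) (hub : ∀ x, |u x| ≤ K) (hu0 : ∀ x ≤ 0, u x = 0) :
    (1 / 2) * opA α (fun x => opA (1 - α) u x ^ 2) t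
      ≤ Real.Gamma α * Real.Gamma (1 - α) * ∫ s in (0:ℝ)..t, opA (1 - α) u s * u s := by
  have hB : 0 < Real.Gamma α * Real.Gamma (1 - α) :=
    mul_pos (Real.Gamma_pos_of_pos hα0) (Real.Gamma_pos_of_pos (by linarith))
  set B := Real.Gamma α * Real.Gamma (1 - α) with hBdef
  set F := opA (1 - α) u with hFdef
  have hβ : 0 < 1 - α := by linarith
  have hF : Continuous F := by
    rw [continuous_iff_continuousAt]
    intro x
    exact (opA_cont hβ (by linarith) hK hu (S := x + 1) (fun x _ => hub x)).continuousAt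
      (Iic_mem_nhds (by linarith))
  obtain ⟨M, hM⟩ := isCompact_Icc.exists_bound_of_continuousOn (hF.continuousOn (s := Icc 0 t))
  have hM0 : 0 ≤ M := (norm_nonneg _).trans (hM 0 ⟨le_rfl, ht.le⟩)
  have hM1 : ∀ x ∈ Ioc 0 t, |F x| ≤ M := fun x hx => hM x ⟨hx.1.le, hx.2⟩
  have hM2 : ∀ x ∈ Ioc 0 t, |F x ^ 2| ≤ M ^ 2 := fun x hx => by
    rw [abs_pow]; exact pow_le_pow_left₀ (abs_nonneg _) (hM1 x hx) 2
  have hm2 : Measurable fun x => F x ^ 2 := by have := hF.measurable; fun_prop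
  set G := opA α (fun x => F x ^ 2) with hG
  have hGc : ContinuousOn G (Iic t) := opA_cont hα0 hα1.le (by positivity) hm2 hM2
  have hGi : ∀ a b, a ≤ t → b ≤ t → IntervalIntegrable G volume a b := fun a b ha hb =>
    (hGc.mono (by intro x hx; exact hx.2.trans (max_le ha hb))).intervalIntegrable
  have hul : LocallyIntegrable u := by
    refine (locallyIntegrable_const K).mono hu.aestronglyMeasurable
      (Filter.Eventually.of_forall fun x => ?_)
    rw [Real.norm_eq_abs, Real.norm_eq_abs, abs_of_nonneg hK]; exact hub x
  have hui : ∀ a b, IntervalIntegrable u volume a b := fun a b =>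
    intervalIntegrable_iff.mpr
      ((LocallyIntegrable.integrableOn_isCompact hul isCompact_uIcc).mono_set uIoc_subset_uIcc)
  have hU : ∀ s, opA α F s = B * ∫ z in (0:ℝ)..s, u z := by
    intro s
    rcases le_total 0 s with h | h
    · exact abel_inv hα0 hα1 h hu (fun x _ => hub x)
    · rw [opA_nonpos h, intervalIntegral.integral_zero_ae, mul_zero]
      refine Filter.Eventually.of_forall fun x hx => ?_
      rw [uIoc_of_ge h] at hx
      exact hu0 x hx.2
  have hUc : Continuous (opA α F) := by
    have : opA α F = fun s => B * ∫ z in (0:ℝ)..s, u z := funext hU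
    rw [this]
    exact (intervalIntegral.continuous_primitive hui 0).const_mul B |>.comp continuous_id
  -- difference inequality
  set C := 2 * K / (1 - α) with hC
  set C2 := 2 * M ^ 2 / α with hC2
  have step : ∀ h, 0 < h → (1 / 2) * (G t - C2 * h ^ α) - (1 / 2) * (C ^ 2 * h ^ (1 - α) * t)
      ≤ ∫ s in (0:ℝ)..t, F s * (h⁻¹ * (opA α F s - opA α F (s - h))) := by
    intro h hh
    have i1 : IntervalIntegrable (fun s => F s * (opA α F s - opA α F (s - h))) volume 0 t :=
      Continuous.intervalIntegrable (by fun_prop) _ _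
    have g1 := hGi 0 t ht.le le_rfl
    have g2 : IntervalIntegrable (fun s => G (s - h)) volume 0 t := by
      have := (hGi (0 - h) (t - h) (by linarith) (by linarith)).comp_sub_right h
      simpa using this
    have a1 := intervalIntegral.integral_mono_on ht.le
      ((((g1.sub g2).const_mul (1/2))).sub
        (intervalIntegrable_const (c := (1 / 2) * (C ^ 2 * h ^ (1 - α) * h)))) i1
      (fun s hs => core_ptwise hα0 hα1 hh hF
        (fun x y _ hxy hy => opA_holder hβ (by linarith) hK hu (S := t) (fun x _ => hub x) hxy hy)
        hs.1 hs.2)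
    rw [intervalIntegral.integral_sub ((g1.sub g2).const_mul (1/2)) intervalIntegrable_const,
      intervalIntegral.integral_const_mul, intervalIntegral.integral_sub g1 g2,
      intervalIntegral.integral_comp_sub_right, intervalIntegral.integral_const] at a1
    have a2 : (∫ x in (0:ℝ)..t, G x) - ∫ x in (0 - h)..(t - h), G x = ∫ x in (t - h)..t, G x := by
      have z : ∫ x in (0 - h)..0, G x = 0 := by
        apply intervalIntegral.integral_zero_ae
        refine Filter.Eventually.of_forall fun x hx => ?_
        rw [uIoc_of_le (by linarith)] at hx
        exact opA_nonpos hx.2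
      have z1 := intervalIntegral.integral_add_adjacent_intervals
        (hGi (0 - h) 0 (by linarith) ht.le) g1
      have z2 := intervalIntegral.integral_add_adjacent_intervals
        (hGi (0 - h) (t - h) (by linarith) (by linarith)) (hGi (t - h) t (by linarith) le_rfl)
      linarith
    have a3 : h * (G t - C2 * h ^ α) ≤ ∫ x in (t - h)..t, G x := by
      have := intervalIntegral.integral_mono_on (μ := volume) (show t - h ≤ t by linarith)
        (intervalIntegrable_const (c := G t - C2 * h ^ α)) (hGi (t - h) t (by linarith) le_rfl)
        (fun x hx => by
          have h1 := opA_holder hα0 hα1.le (by positivity) hm2 hM2 hx.2 (le_refl t)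
          have h2 : (t - x) ^ α ≤ h ^ α :=
            Real.rpow_le_rpow (by linarith [hx.2]) (by linarith [hx.1]) hα0.le
          have h3 : C2 * (t - x) ^ α ≤ C2 * h ^ α :=
            mul_le_mul_of_nonneg_left h2 (by positivity)
          have h4 := (le_abs_self _).trans (h1.trans h3)
          linarith)
      rw [intervalIntegral.integral_const] at this
      simpa using this
    have a4 : ∫ s in (0:ℝ)..t, F s * (h⁻¹ * (opA α F s - opA α F (s - h)))
        = h⁻¹ * ∫ s in (0:ℝ)..t, F s * (opA α F s - opA α F (s - h)) := by
      rw [← intervalIntegral.integral_const_mul]; congr 1; ext s; ring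
    rw [a4, inv_mul_eq_div, le_div_iff₀ hh]
    rw [a2] at a1
    simp only [smul_eq_mul, sub_zero] at a1
    linarith
  -- pass to the limit
  have lim1 : Filter.Tendsto
      (fun h => ∫ s in (0:ℝ)..t, F s * (h⁻¹ * (opA α F s - opA α F (s - h))))
      (nhdsWithin 0 (Ioi 0)) (nhds (∫ s in (0:ℝ)..t, F s * (B * u s))) := by
    apply intervalIntegral.tendsto_integral_filter_of_dominated_convergence (fun _ => M * (B * K))
    · refine Filter.Eventually.of_forall fun h => Continuous.aestronglyMeasurable (by fun_prop)
    · filter_upwards [self_mem_nhdsWithin] with h (hh : 0 < h)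
      refine Filter.Eventually.of_forall fun s hs => ?_
      rw [uIoc_of_le ht.le] at hs
      rw [norm_mul]
      apply mul_le_mul (hM1 s hs) _ (norm_nonneg _) hM0
      rw [hU, hU, ← mul_sub, intervalIntegral.integral_interval_sub_left (hui _ _) (hui _ _)]
      have := intervalIntegral.norm_integral_le_of_norm_le_const (a := s - h) (b := s) (f := u)
        (C := K) (fun x _ => hub x)
      rw [norm_mul, norm_mul, Real.norm_of_nonneg hB.le, Real.norm_of_nonneg (inv_nonneg.2 hh.le)]
      rw [sub_sub_cancel, abs_of_pos hh] at this
      rw [inv_mul_eq_div, div_le_iff₀ hh, mul_assoc B K h]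
      exact mul_le_mul_of_nonneg_left this hB.le
    · exact intervalIntegrable_const
    · filter_upwards [LocallyIntegrable.ae_hasDerivAt_integral hul] with s hs _
      have hd : HasDerivAt (opA α F) (B * u s) s := by
        have : opA α F = fun s => B * ∫ z in (0:ℝ)..s, u z := funext hU
        rw [this]
        exact (hs 0).const_mul B
      refine Filter.Tendsto.const_mul _ ?_
      have h1 := hd.tendsto_slope_zero_left
      have h2 : Filter.Tendsto (fun h : ℝ => -h) (nhdsWithin 0 (Ioi 0)) (nhdsWithin 0 (Iio 0)) := by
        have := tendsto_neg_nhdsGT (a := (0:ℝ))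
        simpa using this
      refine (h1.comp h2).congr fun h => ?_
      simp only [Function.comp, smul_eq_mul, inv_neg, ← sub_eq_add_neg]
      ring
  have lim2 : Filter.Tendsto
      (fun h : ℝ => (1 / 2) * (G t - C2 * h ^ α) - (1 / 2) * (C ^ 2 * h ^ (1 - α) * t))
      (nhdsWithin 0 (Ioi 0)) (nhds ((1 / 2) * G t)) := by
    have hc : Continuous
        (fun h : ℝ => (1 / 2) * (G t - C2 * h ^ α) - (1 / 2) * (C ^ 2 * h ^ (1 - α) * t)) := by
      have c1 : Continuous fun h : ℝ => h ^ α :=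
        Continuous.rpow_const continuous_id (fun _ => Or.inr hα0.le)
      have c2 : Continuous fun h : ℝ => h ^ (1 - α) :=
        Continuous.rpow_const continuous_id (fun _ => Or.inr hβ.le)
      fun_prop
    have := (hc.tendsto 0).mono_left (nhdsWithin_le_nhds (s := Ioi 0))
    simpa [Real.zero_rpow hα0.ne', Real.zero_rpow hβ.ne'] using this
  have fin := le_of_tendsto_of_tendsto lim2 lim1 (by
    filter_upwards [self_mem_nhdsWithin] with h hh using step h hh)
  refine fin.trans (le_of_eq ?_)
  rw [← intervalIntegral.integral_const_mul]
  congr 1; ext s; ring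

lemma opA_continuous {β K : ℝ} (hβ : 0 < β) (hβ1 : β ≤ 1) (hK : 0 ≤ K) {u : ℝ → ℝ}
    (hu : Measurable u) (hub : ∀ x, |u x| ≤ K) : Continuous (opA β u) := by
  rw [continuous_iff_continuousAt]
  intro x
  exact (opA_cont hβ hβ1 hK hu (S := x + 1) (fun x _ => hub x)).continuousAt
    (Iic_mem_nhds (by linarith))

lemma opA_lower {α t : ℝ} (hα0 : 0 < α) (hα1 : α < 1) (ht : 0 < t) {F : ℝ → ℝ}
    (hF : Continuous F) :
    t ^ (α - 1) * ∫ s in (0:ℝ)..t, F s ^ 2 ≤ opA α (fun x => F x ^ 2) t := by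
  obtain ⟨M, hM⟩ := isCompact_Icc.exists_bound_of_continuousOn
    ((hF.pow 2).continuousOn (s := Icc 0 t))
  rw [opA, ← intervalIntegral.integral_const_mul]
  refine intervalIntegral.integral_mono_on_of_le_Ioo ht.le
    (Continuous.intervalIntegrable (by fun_prop) _ _)
    (kerL_mul_int hα0 t ht.le (by have := hF.measurable; fun_prop)
      (fun x hx => hM x ⟨hx.1.le, hx.2⟩)) ?_
  intro x hx
  apply mul_le_mul_of_nonneg_right _ (sq_nonneg _)
  rw [← kerL_of_pos ht]
  exact kerL_anti hα1.le (by linarith [hx.2]) (by linarith [hx.1])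

/-- For `α ∈ (0,1)`, `b₂ > 0` and `w ∈ W^{1,∞}(0,T)` with `w(0)=0` and
`(∂_t^α w)² ∈ W^{1,1}(0,T)`,
`∫₀ᵗ ∂_t^α w · (b₂ ∂_t^α w + w)' ds ≥ (b₂/2)|∂_t^α w(t)|² + (1/(2Γ(α)t^{1-α}))‖∂_t^α w‖²_{L²(0,t)}`. -/
theorem caputo_zener_coercivity (α b₂ T : ℝ) (hα : α ∈ Set.Ioo (0:ℝ) 1)
    (hb : 0 < b₂) (hT : 0 < T)
    (w : ℝ → ℝ) (K : NNReal) (hw : LipschitzOnWith K w (Set.Icc 0 T))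
    (hw0 : w 0 = 0)
    (hdiff : ∀ t ∈ Set.Ioo (0:ℝ) T, DifferentiableAt ℝ (fun r => caputo α w r) t)
    (hac : ∀ t ∈ Set.Icc (0:ℝ) T,
      (caputo α w t) ^ 2 = (caputo α w 0) ^ 2
        + ∫ s in (0:ℝ)..t, deriv (fun r => (caputo α w r) ^ 2) s)
    (hint : IntervalIntegrable (deriv (fun r => (caputo α w r) ^ 2)) volume 0 T) :
    ∀ t ∈ Set.Ioo (0:ℝ) T,
      (∫ s in (0:ℝ)..t,
          caputo α w s * deriv (fun r => b₂ * caputo α w r + w r) s)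
        ≥ (b₂ / 2) * (caputo α w t) ^ 2
          + (1 / (2 * Real.Gamma α * t ^ (1 - α)))
              * ∫ s in (0:ℝ)..t, (caputo α w s) ^ 2 := by
  intro t ht
  obtain ⟨hα0, hα1⟩ := hα
  have hβ : 0 < 1 - α := by linarith
  have hΓ := Real.Gamma_pos_of_pos hα0
  have hΓ' := Real.Gamma_pos_of_pos hβ
  set u : ℝ → ℝ := (Ioo 0 T).indicator (deriv w) with hu
  have hum : Measurable u := (measurable_deriv w).indicator measurableSet_Ioo
  have hub : ∀ x, |u x| ≤ (K : ℝ) := by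
    intro x
    by_cases hx : x ∈ Ioo 0 T
    · rw [hu, indicator_of_mem hx]
      exact norm_deriv_le_of_lipschitzOn (Icc_mem_nhds hx.1 hx.2) hw
    · rw [hu, indicator_of_notMem hx, abs_zero]
      exact K.2
  have hu0 : ∀ x ≤ 0, u x = 0 := fun x hx =>
    indicator_of_notMem (fun h => absurd h.1 (not_lt.2 hx)) _
  set F := opA (1 - α) u with hF
  have hFc : Continuous F := opA_continuous hβ (by linarith) K.2 hum hub
  have hcap : ∀ s, 0 ≤ s → s < T → caputo α w s = (1 / Real.Gamma (1 - α)) * F s := by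
    intro s h0 hs
    rw [caputo, abel, hF, opA]
    congr 1
    have hns : ∀ᵐ z : ℝ, z ≠ s := by simp [ae_iff, measure_singleton]
    apply intervalIntegral.integral_congr_ae
    filter_upwards [hns] with x hx hx'
    rw [uIoc_of_le h0] at hx'
    have hlt : x < s := lt_of_le_of_ne hx'.2 hx
    rw [kerL_of_pos (by linarith), hu, indicator_of_mem (show x ∈ Ioo 0 T from ⟨hx'.1, by linarith⟩),
      div_eq_mul_inv, ← Real.rpow_neg (by linarith), mul_comm]
    congr 2; ring
  set c := caputo α w with hc
  set g := 1 / Real.Gamma (1 - α) with hg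
  have hg0 : 0 < g := by positivity
  have hc0 : c 0 = 0 := by simp [hc, caputo, abel]
  have hwd : ∀ᵐ s : ℝ, s ∈ uIcc 0 T → DifferentiableAt ℝ w s :=
    (LipschitzOnWith.absolutelyContinuousOnInterval
      (by rw [uIcc_of_le hT.le]; exact hw)).ae_differentiableAt
  have huI : IntervalIntegrable u volume 0 t := by
    rw [intervalIntegrable_iff_integrableOn_Ioc_of_le ht.1.le]
    exact Measure.integrableOn_of_bounded (M := K) (by simp) hum.aestronglyMeasurable
      (Filter.Eventually.of_forall hub)
  have hFu : IntervalIntegrable (fun s => F s * u s) volume 0 t :=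
    huI.continuousOn_mul hFc.continuousOn
  have hd1 : IntervalIntegrable (deriv (fun r => (c r) ^ 2)) volume 0 t :=
    hint.mono_set (by
      rw [uIcc_of_le hT.le, uIcc_of_le ht.1.le]
      exact Icc_subset_Icc_right ht.2.le)
  have e1 : ∫ s in (0:ℝ)..t, c s * deriv (fun r => b₂ * c r + w r) s
      = ∫ s in (0:ℝ)..t, ((b₂ / 2) * deriv (fun r => (c r) ^ 2) s + g * (F s * u s)) := by
    apply intervalIntegral.integral_congr_ae
    filter_upwards [hwd] with s hs hs'
    rw [uIoc_of_le ht.1.le] at hs'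
    have hsT : s ∈ Ioo 0 T := ⟨hs'.1, hs'.2.trans_lt ht.2⟩
    have hws := hs (by rw [uIcc_of_le hT.le]; exact ⟨hsT.1.le, hsT.2.le⟩)
    have hcs : DifferentiableAt ℝ c s := hdiff s hsT
    have d1 := ((hcs.hasDerivAt.const_mul b₂).add hws.hasDerivAt).deriv
    have d2 := (hcs.hasDerivAt.pow 2).deriv
    have d1' : deriv (fun r => b₂ * c r + w r) s = b₂ * deriv c s + deriv w s := d1
    have d2' : deriv (fun r => (c r) ^ 2) s = 2 * c s * deriv c s := by
      have d3 : deriv (fun r => (c r) ^ 2) s = _ := d2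
      rw [d3]; simp
    have hus : u s = deriv w s := indicator_of_mem hsT _
    rw [d1', d2', hus]
    linear_combination deriv w s * hcap s hsT.1.le hsT.2
  have e2 : ∫ s in (0:ℝ)..t, (c s) ^ 2 = g ^ 2 * ∫ s in (0:ℝ)..t, F s ^ 2 := by
    rw [← intervalIntegral.integral_const_mul]
    apply intervalIntegral.integral_congr
    intro s hs
    rw [uIcc_of_le ht.1.le] at hs
    simp only
    rw [hcap s hs.1 (hs.2.trans_lt ht.2)]
    ring
  have e3 : ∫ s in (0:ℝ)..t, deriv (fun r => (c r) ^ 2) s = c t ^ 2 := by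
    have := hac t ⟨ht.1.le, ht.2.le⟩
    rw [hc0] at this
    linarith
  rw [e1, intervalIntegral.integral_add (hd1.const_mul _) (hFu.const_mul _),
    intervalIntegral.integral_const_mul, intervalIntegral.integral_const_mul, e3, e2]
  have k1 := core hα0 hα1 ht.1 K.2 hum hub hu0
  have k2 := opA_lower hα0 hα1 ht.1 hFc
  have k3 := (mul_le_mul_of_nonneg_left k2 (by norm_num : (0:ℝ) ≤ 1 / 2)).trans k1
  have htp : 0 < t ^ (1 - α) := Real.rpow_pos_of_pos ht.1 _
  have htα : t ^ (α - 1) = (t ^ (1 - α))⁻¹ := by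
    rw [← Real.rpow_neg ht.1.le]; congr 1; ring
  rw [htα] at k3
  have k4 := mul_le_mul_of_nonneg_left k3 (show 0 ≤ g ^ 2 / Real.Gamma α by positivity)
  have r1 : g ^ 2 / Real.Gamma α * (Real.Gamma α * Real.Gamma (1 - α)
      * ∫ s in (0:ℝ)..t, F s * u s) = g * ∫ s in (0:ℝ)..t, F s * u s := by
    rw [hg]; field_simp
  have r2 : g ^ 2 / Real.Gamma α * (1 / 2 * ((t ^ (1 - α))⁻¹ * ∫ s in (0:ℝ)..t, F s ^ 2))
      = 1 / (2 * Real.Gamma α * t ^ (1 - α)) * (g ^ 2 * ∫ s in (0:ℝ)..t, F s ^ 2) := by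
    field_simp
  rw [r2] at k4
  have k5 := k4.trans_eq r1
  linarith
end
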